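/- arXiv:1405.6512 — 4 statements merged into one kernel-verified Lean document; each statement's English description precedes it below -/
import Mathlib

section
/- Let R = ℤ[x,x⁻¹] and let V and W be R-modules on which the generator x acts as the identity (x_V = id_V and x_W = id_W). Then Ext²_R(V,W) is isomorphic to Ext¹_ℤ(V,W). -/
/-!
STATEMENT 5: Let R = ℤ[x,x⁻¹] and let V and W be R-modules on which the generator x acts as
the identity. Then Ext²_R(V,W) is isomorphic to Ext¹_ℤ(V,W).
-/

open CategoryTheory

noncomputable section

attribute [local instance] HasDerivedCategory.standard

instance (A : Type) [Ring A] : HasExt.{1} (ModuleCat.{0} A) :=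
  hasExt_of_hasDerivedCategory _

section

universe w w' v v' u u'

open Limits Abelian

namespace CategoryTheory.Adjunction

variable {C : Type u} [Category.{v} C] [Abelian C] {D : Type u'} [Category.{v'} D] [Abelian D]
  {F : C ⥤ D} {G : D ⥤ C} [F.Additive] [PreservesFiniteLimits F] [PreservesFiniteColimits F]
  [HasExt.{w} C] [HasExt.{w'} D]

/-- For `F ⊣ G` with `F` exact, the map `Ext X (G Y) n → Ext (F X) Y n` obtained by applying `F`
and then composing with the counit. -/
def extHom (adj : F ⊣ G) (X : C) (Y : D) (n : ℕ) :
    Ext.{w} X (G.obj Y) n →+ Ext.{w'} (F.obj X) Y n :=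
  ((Ext.mk₀ (adj.counit.app Y)).postcomp (F.obj X) (add_zero n)).comp
    (F.mapExtAddHom X (G.obj Y) n)

lemma extHom_apply (adj : F ⊣ G) {X : C} {Y : D} {n : ℕ} (e : Ext.{w} X (G.obj Y) n) :
    adj.extHom.{w, w'} X Y n e =
      (e.mapExactFunctor F).comp (Ext.mk₀ (adj.counit.app Y)) (add_zero n) :=
  rfl

lemma extHom_mk₀_comp (adj : F ⊣ G) {X X' : C} {Y : D} {n : ℕ} (f : X' ⟶ X)
    (e : Ext.{w} X (G.obj Y) n) :
    adj.extHom.{w, w'} X' Y n ((Ext.mk₀ f).comp e (zero_add n)) =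
      (Ext.mk₀ (F.map f)).comp (adj.extHom.{w, w'} X Y n e) (zero_add n) := by
  rw [extHom_apply, extHom_apply, Ext.mapExactFunctor_comp, Ext.mapExactFunctor_mk₀,
    Ext.comp_assoc_of_third_deg_zero]

lemma extHom_extClass_comp (adj : F ⊣ G) {S : ShortComplex C} (hS : S.ShortExact) {Y : D}
    {n m : ℕ} (h : 1 + n = m) (e : Ext.{w} S.X₁ (G.obj Y) n) :
    adj.extHom.{w, w'} S.X₃ Y m (hS.extClass.comp e h) =
      (hS.map_of_exact F).extClass.comp (adj.extHom.{w, w'} S.X₁ Y n e) h := by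
  rw [extHom_apply, extHom_apply, Ext.mapExactFunctor_comp, Ext.mapExactFunctor_extClass]
  exact Ext.comp_assoc_of_third_deg_zero _ _ _ _

lemma extHom_bijective (adj : F ⊣ G) [EnoughProjectives C] [F.PreservesProjectiveObjects]
    (X : C) (Y : D) (n : ℕ) : Function.Bijective (adj.extHom.{w, w'} X Y n) := by
  induction n generalizing X with
  | zero =>
    have h : ⇑(adj.extHom.{w, w'} X Y 0) =
        Ext.homEquiv₀.symm ∘ (adj.homEquiv X Y).symm ∘ Ext.homEquiv₀ := by
      ext x
      obtain ⟨f, rfl⟩ := (Ext.mk₀_bijective X (G.obj Y)).2 x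
      simp [extHom_apply, Ext.mapExactFunctor_mk₀, Ext.homEquiv₀, adj.homEquiv_counit]
    rw [h]
    exact (Equiv.bijective _).comp ((Equiv.bijective _).comp (Equiv.bijective _))
  | succ n hn =>
    let P : ProjectivePresentation X := Classical.arbitrary _
    let S := ShortComplex.mk _ _ (kernel.condition P.f)
    have : Projective (S.map F).X₂ := Functor.PreservesProjectiveObjects.projective_obj P.projective
    have hS : S.ShortExact := { exact := ShortComplex.exact_kernel P.f }
    exact AddMonoidHom.bijective_of_surjective_of_bijective_of_right_exact _ _ _ _
      (adj.extHom S.X₂ Y n) (adj.extHom S.X₁ Y n) (adj.extHom S.X₃ Y (n + 1))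
      (AddMonoidHom.ext fun e ↦ (adj.extHom_mk₀_comp S.f e).symm)
      (AddMonoidHom.ext fun e ↦ (adj.extHom_extClass_comp hS (add_comm 1 n) e).symm)
      ((ShortComplex.ab_exact_iff_function_exact _).1
        (Ext.contravariant_sequence_exact₁' hS (G.obj Y) n (n + 1) (add_comm 1 n)))
      ((ShortComplex.ab_exact_iff_function_exact _).1
        (Ext.contravariant_sequence_exact₁' (hS.map F) Y n (n + 1) (add_comm 1 n)))
      (hn _).surjective (hn _)
      (fun x₃ ↦ Ext.contravariant_sequence_exact₃ hS _ x₃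
        (Ext.eq_zero_of_projective _) (add_comm 1 n))
      (fun y₃ ↦ Ext.contravariant_sequence_exact₃ (hS.map F) _ y₃
        (Ext.eq_zero_of_projective _) (add_comm 1 n))

/-- For `F ⊣ G` with `F` exact and preserving projectives, `Ext X (G Y) n ≃+ Ext (F X) Y n`. -/
def extAddEquiv (adj : F ⊣ G) [EnoughProjectives C] [F.PreservesProjectiveObjects]
    (X : C) (Y : D) (n : ℕ) : Ext.{w} X (G.obj Y) n ≃+ Ext.{w'} (F.obj X) Y n :=
  AddEquiv.ofBijective _ (adj.extHom_bijective X Y n)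

end CategoryTheory.Adjunction

/-- Over a ring whose ideals are projective, quotients of injective modules are injective. -/
lemma Module.Baer.of_surjective {R : Type*} [Ring R] [∀ I : Ideal R, Module.Projective R I]
    {M N : Type*} [AddCommGroup M] [AddCommGroup N] [Module R M] [Module R N]
    (hM : Module.Baer R M) (p : M →ₗ[R] N) (hp : Function.Surjective p) : Module.Baer R N := by
  intro I g
  obtain ⟨l, hl⟩ := Module.projective_lifting_property p g hp
  obtain ⟨l', hl'⟩ := hM I l
  exact ⟨p ∘ₗ l', fun x hx ↦ by simp [hl' x hx, ← hl]⟩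

lemma ModuleCat.subsingleton_ext_add_two {R : Type u} [Ring R]
    [∀ I : Ideal R, Module.Projective R I] [HasExt.{w} (ModuleCat.{u} R)]
    (X Y : ModuleCat.{u} R) (n : ℕ) : Subsingleton (Ext X Y (n + 2)) := by
  let P : InjectivePresentation Y := Classical.arbitrary _
  let S := ShortComplex.mk _ _ (cokernel.condition P.f)
  have hS : S.ShortExact := { exact := ShortComplex.exact_cokernel P.f }
  have : Injective S.X₂ := P.injective
  have hX₂ : Module.Injective R S.X₂ := Module.injective_module_of_injective_object R S.X₂
  have : Module.Injective R S.X₃ :=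
    ((Module.Baer.iff_injective.2 hX₂).of_surjective S.g.hom hS.moduleCat_surjective_g).injective
  have : Injective S.X₃ := Module.injective_object_of_injective_module R S.X₃
  refine subsingleton_of_forall_eq 0 fun x ↦ ?_
  obtain ⟨y, rfl⟩ := Ext.covariant_sequence_exact₁ X hS x (Ext.eq_zero_of_injective _) rfl
  rw [y.eq_zero_of_injective, Ext.zero_comp]

section ExtendScalars

variable {k A : Type u} [CommRing k] [CommRing A] {f : k →+* A}

instance : (ModuleCat.extendScalars.{u, u, u} f).PreservesProjectiveObjects :=
  Functor.preservesProjectiveObjects_of_adjunction_of_preservesEpimorphisms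
    (ModuleCat.extendRestrictScalarsAdj.{u, u, u} f)

/-- Base change for `Ext` along a flat ring homomorphism. -/
def ModuleCat.extExtendScalarsAddEquiv (hf : f.Flat)
    [HasExt.{w} (ModuleCat.{u} k)] [HasExt.{w'} (ModuleCat.{u} A)]
    (X : ModuleCat.{u} k) (Y : ModuleCat.{u} A) (n : ℕ) :
    Ext.{w} X ((restrictScalars f).obj Y) n ≃+ Ext.{w'} ((extendScalars f).obj X) Y n :=
  have := preservesFiniteLimits_extendScalars_of_flat hf
  have adj := extendRestrictScalarsAdj.{u, u, u} f
  have := adj.left_adjoint_additive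
  have : PreservesFiniteColimits (extendScalars.{u, u, u} f) :=
    have := adj.leftAdjoint_preservesColimits
    inferInstance
  adj.extAddEquiv X Y n

end ExtendScalars

namespace LaurentPolynomial

variable {k : Type u} [CommRing k]

open TensorProduct

lemma injective_T_sub_one_smul (V : Type*) [AddCommGroup V] [Module k V] :
    Function.Injective
      (fun z : LaurentPolynomial k ⊗[k] V ↦ (T 1 - 1 : LaurentPolynomial k) • z) := by
  let e := TensorProduct.equivFinsuppOfBasisLeft (N := V) (AddMonoidAlgebra.basis ℤ k)
  have he (z : LaurentPolynomial k ⊗[k] V) (n : ℤ) :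
      e ((T 1 : LaurentPolynomial k) • z) (n + 1) = e z n := by
    induction z with
    | zero => simp
    | add x y hx hy => simp [smul_add, hx, hy]
    | tmul p v =>
      rw [TensorProduct.smul_tmul', TensorProduct.equivFinsuppOfBasisLeft_apply_tmul_apply,
        TensorProduct.equivFinsuppOfBasisLeft_apply_tmul_apply]
      congr 1
      change (AddMonoidAlgebra.single 1 1 * p).coeff (n + 1) = p.coeff n
      rw [add_comm, AddMonoidAlgebra.coeff_single_mul_add, one_mul]
  refine (injective_iff_map_eq_zero (DistribSMul.toAddMonoidHom
    (LaurentPolynomial k ⊗[k] V) (T 1 - 1 : LaurentPolynomial k))).2 fun z hz ↦ ?_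
  have hz' : (T 1 : LaurentPolynomial k) • z = z := by
    simpa [sub_smul, sub_eq_zero] using hz
  have h (n : ℤ) : e z (n + 1) = e z n := by rw [← he z n, hz']
  have h0 (n : ℤ) : e z n = e z 0 := by
    induction n with
    | zero => rfl
    | succ n ih => rw [h, ih]
    | pred n ih => rw [← ih, ← h, sub_add_cancel]
  obtain ⟨n, hn⟩ := Infinite.exists_notMem_finset (e z).support
  refine e.map_eq_zero_iff.1 (Finsupp.ext fun m ↦ ?_)
  rw [h0, ← h0 n, Finsupp.notMem_support_iff.1 hn, Finsupp.zero_apply]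

end LaurentPolynomial

namespace ModuleCat

open TensorProduct ChangeOfRings

variable {k A : Type u} [CommRing k] [CommRing A] (f : k →+* A)

/-- The map `v ↦ 1 ⊗ v` as an additive map. -/
def extendScalarsUnit (V : ModuleCat.{u} k) :
    V →+ (extendScalars.{u, u, u} f).obj V :=
  ((extendRestrictScalarsAdj f).unit.app V).hom.toAddMonoidHom

variable {f}

lemma extendScalarsUnit_smul {V : ModuleCat.{u} k} (r : k) (v : V) :
    extendScalarsUnit f V (r • v) = f r • extendScalarsUnit f V v :=
  ((extendRestrictScalarsAdj f).unit.app V).hom.map_smul r v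

lemma counit_extendScalarsUnit (M : ModuleCat.{u} A) (m : M) :
    ((extendRestrictScalarsAdj f).counit.app M).hom
      (extendScalarsUnit f ((restrictScalars f).obj M) m) = m :=
  LinearMap.congr_fun (ModuleCat.hom_ext_iff.1
    ((extendRestrictScalarsAdj f).right_triangle_components M)) m

lemma extendScalars_induction_on {V : ModuleCat.{u} k}
    {motive : (extendScalars.{u, u, u} f).obj V → Prop} (z : (extendScalars.{u, u, u} f).obj V)
    (smul : ∀ (a : A) (v : V), motive (a • extendScalarsUnit f V v))
    (add : ∀ x y, motive x → motive y → motive (x + y)) : motive z := by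
  refine TensorProduct.induction_on (motive := motive) z ?_ (fun a v ↦ ?_) add
  · simpa using! smul 0 0
  · have h (a : A) (v : V) : a • extendScalarsUnit f V v = a ⊗ₜ[k,f] v :=
      congrArg (· ⊗ₜ[k,f] v) (mul_one a)
    exact h a v ▸ smul a v

end ModuleCat

namespace LaurentPolynomial

variable {k : Type u} [CommRing k]

section

variable {V : Type*} [AddCommGroup V] [Module (LaurentPolynomial k) V]

lemma T_smul_of_T_one_smul (hV : ∀ v : V, (T 1 : LaurentPolynomial k) • v = v) (n : ℤ) (v : V) :
    (T n : LaurentPolynomial k) • v = v := by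
  induction n generalizing v with
  | zero => rw [T_zero, one_smul]
  | succ n ih => rw [T_add, mul_smul, hV, ih]
  | pred n ih =>
    nth_rw 1 [← hV v]
    rw [← mul_smul, ← T_add, sub_add_cancel, ih]

lemma exists_T_one_sub_one_smul_eq (n : ℤ) (v : V) :
    ∃ w : V, (T 1 - 1 : LaurentPolynomial k) • w = (T n : LaurentPolynomial k) • v - v := by
  induction n with
  | zero => exact ⟨0, by simp⟩
  | succ n ih =>
    obtain ⟨w, hw⟩ := ih
    refine ⟨w + (T n : LaurentPolynomial k) • v, ?_⟩
    rw [smul_add, hw, sub_smul, ← mul_smul, ← T_add, add_comm 1, one_smul]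
    abel
  | pred n ih =>
    obtain ⟨w, hw⟩ := ih
    refine ⟨w - (T (-n - 1) : LaurentPolynomial k) • v, ?_⟩
    rw [smul_sub, hw, sub_smul, ← mul_smul, ← T_add, add_sub_cancel, one_smul]
    abel

end

open scoped TensorProduct

open ModuleCat

/-- The restriction of scalars of `k[T;T⁻¹]` along `C` is `k[T;T⁻¹]` with its `k`-module
structure. -/
def restrictScalarsCEquiv (k : Type u) [CommRing k] :
    (restrictScalars (C (R := k))).obj (.of (LaurentPolynomial k) (LaurentPolynomial k)) ≃ₗ[k]
      LaurentPolynomial k :=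
  { AddEquiv.refl (LaurentPolynomial k) with
    map_smul' r p := (smul_eq_C_mul r (p : LaurentPolynomial k)).symm }

/-- Extension of scalars along `C` in terms of the tensor product over `k`. -/
def extendScalarsCEquiv (V : ModuleCat.{u} k) :
    (extendScalars.{u, u, u} (C (R := k))).obj V ≃+ LaurentPolynomial k ⊗[k] V :=
  (TensorProduct.congr (restrictScalarsCEquiv k) (LinearEquiv.refl k V)).toAddEquiv

lemma extendScalarsCEquiv_smul (V : ModuleCat.{u} k) (p : LaurentPolynomial k)
    (z : (extendScalars.{u, u, u} (C (R := k))).obj V) :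
    extendScalarsCEquiv V (p • z) = p • extendScalarsCEquiv V z := by
  induction z using ModuleCat.extendScalars_induction_on with
  | add x y hx hy => rw [smul_add, map_add, hx, hy, map_add, smul_add]
  | smul q v =>
    rw [← mul_smul]
    change ((p * q) * 1) ⊗ₜ[k] v = (p * (q * 1)) ⊗ₜ[k] v
    rw [mul_assoc]

variable (M : ModuleCat.{u} (LaurentPolynomial k))

lemma exists_T_one_sub_one_smul_eq_sub_counit (hM : ∀ m : M, (T 1 : LaurentPolynomial k) • m = m)
    (z : (extendScalars C).obj ((restrictScalars C).obj M)) :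
    ∃ w : (extendScalars C).obj ((restrictScalars C).obj M),
      (T 1 - 1 : LaurentPolynomial k) • w = z - extendScalarsUnit C ((restrictScalars C).obj M)
        (((extendRestrictScalarsAdj (C (R := k))).counit.app M).hom z) := by
  let N := (extendScalars.{u, u, u} (C (R := k))).obj ((restrictScalars C).obj M)
  let ε : N →ₗ[LaurentPolynomial k] M := ((extendRestrictScalarsAdj C).counit.app M).hom
  let δ : N →+ N := AddMonoidHom.id N -
    AddMonoidHom.comp (extendScalarsUnit C ((restrictScalars C).obj M)) ε.toAddMonoidHom
  suffices δ z ∈ (DistribSMul.toAddMonoidHom N (T 1 - 1 : LaurentPolynomial k)).range from this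
  induction z using ModuleCat.extendScalars_induction_on with
  | add x y hx hy => exact (δ.map_add x y).symm ▸ add_mem hx hy
  | smul p v =>
    induction p using LaurentPolynomial.induction_on' with
    | add p q hp hq => exact (add_smul p q
        (extendScalarsUnit C ((restrictScalars C).obj M) v)).symm ▸
          (δ.map_add _ _).symm ▸ add_mem hp hq
    | C_mul_T n r =>
      let m := extendScalarsUnit C ((restrictScalars C).obj M) (r • v)
      obtain ⟨w, hw⟩ := exists_T_one_sub_one_smul_eq (k := k) n m
      have h : (C r * T n) • extendScalarsUnit C ((restrictScalars C).obj M) v =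
          (T n : LaurentPolynomial k) • m := by
        rw [mul_comm, mul_smul, ← extendScalarsUnit_smul]
      have h' : ((extendRestrictScalarsAdj (C (R := k))).counit.app M).hom
          ((T n : LaurentPolynomial k) • m) =
          (r • v : (restrictScalars C).obj M) := by
        have hm : ((extendRestrictScalarsAdj (C (R := k))).counit.app M).hom m =
            (r • v : (restrictScalars C).obj M) := counit_extendScalarsUnit M _
        rw [map_smul, hm]
        exact T_smul_of_T_one_smul hM _ _
      rw [h]
      refine ⟨w, hw.trans ?_⟩
      exact congrArg ((T n : LaurentPolynomial k) • m -
        extendScalarsUnit C ((restrictScalars C).obj M) ·) h'.symm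

/-- The short complex `k[T;T⁻¹] ⊗ M ⟶ k[T;T⁻¹] ⊗ M ⟶ M`, whose first map is multiplication by
`T - 1`, for a module `M` on which `T` acts trivially. -/
def koszulComplex (hM : ∀ m : M, (T 1 : LaurentPolynomial k) • m = m) :
    ShortComplex (ModuleCat.{u} (LaurentPolynomial k)) :=
  .mk ((T 1 - 1 : LaurentPolynomial k) •
      𝟙 ((extendScalars C).obj ((restrictScalars C).obj M)))
    ((extendRestrictScalarsAdj (C (R := k))).counit.app M) (by
      rw [Linear.smul_comp]
      refine ModuleCat.hom_ext (LinearMap.ext fun z ↦ ?_)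
      change (T 1 - 1 : LaurentPolynomial k) • (_ : M) = 0
      rw [sub_smul, one_smul, hM, sub_self])

variable {M} (hM : ∀ m : M, (T 1 : LaurentPolynomial k) • m = m)

lemma koszulComplex_shortExact : (koszulComplex M hM).ShortExact where
  exact := by
    rw [ShortComplex.moduleCat_exact_iff]
    intro z hz
    obtain ⟨w, hw⟩ := exists_T_one_sub_one_smul_eq_sub_counit M hM z
    refine ⟨w, hw.trans ?_⟩
    erw [hz, map_zero, sub_zero]
  mono_f := by
    rw [ModuleCat.mono_iff_injective]
    intro z z' h
    apply (extendScalarsCEquiv _).injective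
    apply injective_T_sub_one_smul (k := k) ((restrictScalars C).obj M)
    exact (extendScalarsCEquiv_smul _ _ z).symm.trans
      ((congrArg (extendScalarsCEquiv _) h).trans (extendScalarsCEquiv_smul _ _ z'))
  epi_g := by
    rw [ModuleCat.epi_iff_surjective]
    exact fun m ↦ ⟨_, counit_extendScalarsUnit M m⟩

end LaurentPolynomial

namespace CategoryTheory

variable {C : Type u} [Category.{v} C] [Abelian C] [HasExt.{w} C]

lemma ShortComplex.ShortExact.precomp_extClass_bijective {S : ShortComplex C}
    (hS : S.ShortExact) {Y : C} {n m : ℕ} (h : 1 + n = m)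
    (hf : ∀ e : Ext S.X₂ Y n, (Ext.mk₀ S.f).comp e (zero_add n) = 0)
    (hX₂ : ∀ e : Ext S.X₂ Y m, e = 0) :
    Function.Bijective (hS.extClass.precomp Y h) := by
  refine ⟨(injective_iff_map_eq_zero _).2 fun e he ↦ ?_, fun e ↦ ?_⟩
  · obtain ⟨e', rfl⟩ := Ext.contravariant_sequence_exact₁ hS Y e h he
    exact hf e'
  · exact Ext.contravariant_sequence_exact₃ hS Y e (hX₂ _) h

lemma Abelian.Ext.mk₀_smul_id_comp_eq_zero {A : Type*} [Ring A] [Linear A C] {X Y : C} {n : ℕ}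
    {a : A} (ha : a • 𝟙 Y = 0) (e : Ext X Y n) :
    (Ext.mk₀ (a • 𝟙 X)).comp e (zero_add n) = 0 := by
  rw [Ext.mk₀_smul, Ext.smul_comp, Ext.mk₀_id_comp, Ext.smul_eq_comp_mk₀, ha, Ext.mk₀_zero,
    Ext.comp_zero]

end CategoryTheory

namespace LaurentPolynomial

variable {k : Type u} [CommRing k]

open ModuleCat

/-- If `k` is hereditary and `T` acts trivially on `M` and `N`, then `Ext² M N` over `k[T;T⁻¹]` is
`Ext¹ M N` over `k`. -/
def extTwoAddEquiv [∀ I : Ideal k, Module.Projective k I]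
    [HasExt.{w} (ModuleCat.{u} k)] [HasExt.{w'} (ModuleCat.{u} (LaurentPolynomial k))]
    {M N : ModuleCat.{u} (LaurentPolynomial k)}
    (hM : ∀ m : M, (T 1 : LaurentPolynomial k) • m = m)
    (hN : ∀ m : N, (T 1 : LaurentPolynomial k) • m = m) :
    Ext.{w'} M N 2 ≃+
      Ext.{w} ((restrictScalars (C (R := k))).obj M) ((restrictScalars (C (R := k))).obj N) 1 :=
  have hC : (C : k →+* LaurentPolynomial k).Flat := by
    rw [show (C : k →+* LaurentPolynomial k) = algebraMap k _ from rfl,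
      RingHom.flat_algebraMap_iff]
    infer_instance
  have hN' : (T 1 - 1 : LaurentPolynomial k) • 𝟙 N = 0 := by
    ext x
    change (T 1 - 1 : LaurentPolynomial k) • x = 0
    rw [sub_smul, one_smul, hN, sub_self]
  ((extExtendScalarsAddEquiv.{w, w'} hC _ N 1).trans
    (.ofBijective _ ((koszulComplex_shortExact hM).precomp_extClass_bijective rfl
      (Ext.mk₀_smul_id_comp_eq_zero hN')
      (fun e ↦ by
        have := subsingleton_ext_add_two.{w} ((restrictScalars (C (R := k))).obj M)
          ((restrictScalars (C (R := k))).obj N) 0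
        exact (extExtendScalarsAddEquiv.{w, w'} hC _ N 2).symm.injective
          (Subsingleton.elim _ _))))).symm

end LaurentPolynomial

end

lemma ModuleCat.restrictScalars_obj_of_eq_of_int {A : Type} [Ring A] (f : ℤ →+* A)
    (V : Type) [AddCommGroup V] [Module A V] :
    (ModuleCat.restrictScalars f).obj (ModuleCat.of A V) = ModuleCat.of ℤ V :=
  congrArg (fun m : Module ℤ V ↦ @ModuleCat.of ℤ _ V _ m) (Subsingleton.elim _ _)

theorem laurent_ext_two_of_trivial_action
    (V W : Type) [AddCommGroup V] [AddCommGroup W]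
    [Module (LaurentPolynomial ℤ) V] [Module (LaurentPolynomial ℤ) W]
    (hV : ∀ v : V, (LaurentPolynomial.T 1 : LaurentPolynomial ℤ) • v = v)
    (hW : ∀ w : W, (LaurentPolynomial.T 1 : LaurentPolynomial ℤ) • w = w) :
    Nonempty
      (Abelian.Ext (ModuleCat.of (LaurentPolynomial ℤ) V)
          (ModuleCat.of (LaurentPolynomial ℤ) W) 2 ≃+
        Abelian.Ext (ModuleCat.of ℤ V) (ModuleCat.of ℤ W) 1) := by
  rw [← ModuleCat.restrictScalars_obj_of_eq_of_int LaurentPolynomial.C V,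
    ← ModuleCat.restrictScalars_obj_of_eq_of_int LaurentPolynomial.C W]
  exact ⟨LaurentPolynomial.extTwoAddEquiv hV hW⟩

end
end

section
/- Let R = ℤ[x,x⁻¹] and let V be an R-module whose underlying abelian group is free (i.e., V is a free ℤ-module after restriction of scalars). Then Ext²_R(V,W) = 0 for every R-module W. -/
/-!
STATEMENT 6: Let R = ℤ[x,x⁻¹] and let V be an R-module whose underlying abelian group is
free (i.e., V is a free ℤ-module after restriction of scalars).
Then Ext²_R(V,W) = 0 for every R-module W.
-/

open CategoryTheory

noncomputable section

attribute [local instance] HasDerivedCategory.standard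

namespace LaurentPolynomial

open scoped TensorProduct

universe u

section CharacteristicSequence

variable {A : Type*} [CommRing A] (V : Type*) [AddCommGroup V] [Module A V]

/-- The coefficients of an element of `A[T;T⁻¹] ⊗ V`. -/
def tensorCoeff : A[T;T⁻¹] ⊗[A] V ≃ₗ[A] ℤ →₀ V :=
  (AddMonoidAlgebra.coeffLinearEquiv A).rTensor V ≪≫ₗ TensorProduct.finsuppScalarLeft A V ℤ

@[simp]
lemma tensorCoeff_tmul (p : A[T;T⁻¹]) (v : V) (n : ℤ) :
    tensorCoeff V (p ⊗ₜ[A] v) n = p.coeff n • v := by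
  simp [tensorCoeff]

variable [Module A[T;T⁻¹] V] [IsScalarTower A A[T;T⁻¹] V]

/-- The action map `A[T;T⁻¹] ⊗ V → V`, `p ⊗ v ↦ p • v`. -/
def actionMap : A[T;T⁻¹] ⊗[A] V →ₗ[A[T;T⁻¹]] V :=
  LinearMap.liftBaseChange A[T;T⁻¹] (LinearMap.id : V →ₗ[A] V)

@[simp]
lemma actionMap_tmul (p : A[T;T⁻¹]) (v : V) : actionMap V (p ⊗ₜ[A] v) = p • v := by
  simp [actionMap]

lemma actionMap_surjective : Function.Surjective (actionMap (A := A) V) :=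
  fun v ↦ ⟨1 ⊗ₜ v, by simp⟩

/-- The endomorphism `p ⊗ v ↦ p * T ⊗ v - p ⊗ T • v` of `A[T;T⁻¹] ⊗ V`. -/
def characteristicMap : A[T;T⁻¹] ⊗[A] V →ₗ[A[T;T⁻¹]] A[T;T⁻¹] ⊗[A] V :=
  LinearMap.lsmul A[T;T⁻¹] (A[T;T⁻¹] ⊗[A] V) (T 1) -
    (Algebra.lsmul A A V (T 1 : A[T;T⁻¹])).baseChange A[T;T⁻¹]

@[simp]
lemma characteristicMap_tmul (p : A[T;T⁻¹]) (v : V) :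
    characteristicMap V (p ⊗ₜ[A] v) = (T 1 * p) ⊗ₜ v - p ⊗ₜ ((T 1 : A[T;T⁻¹]) • v) := by
  simp [characteristicMap, TensorProduct.smul_tmul']

variable {V} in
lemma tmul_sub_one_tmul_smul_mem_range (p : A[T;T⁻¹]) (v : V) :
    p ⊗ₜ[A] v - 1 ⊗ₜ (p • v) ∈ LinearMap.range (characteristicMap (A := A) V) := by
  have hmul (p q : A[T;T⁻¹])
      (hp : ∀ v : V, p ⊗ₜ[A] v - 1 ⊗ₜ (p • v) ∈ LinearMap.range (characteristicMap (A := A) V))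
      (hq : ∀ v : V, q ⊗ₜ[A] v - 1 ⊗ₜ (q • v) ∈ LinearMap.range (characteristicMap (A := A) V))
      (v : V) :
      (p * q) ⊗ₜ[A] v - 1 ⊗ₜ ((p * q) • v) ∈ LinearMap.range (characteristicMap (A := A) V) := by
    convert add_mem (Submodule.smul_mem _ p (hq v)) (hp (q • v)) using 1
    rw [smul_sub, TensorProduct.smul_tmul', TensorProduct.smul_tmul', smul_eq_mul, smul_eq_mul,
      mul_one, sub_add_sub_cancel, mul_smul]
  have hT (v : V) :
      T 1 ⊗ₜ[A] v - 1 ⊗ₜ ((T 1 : A[T;T⁻¹]) • v) ∈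
        LinearMap.range (characteristicMap (A := A) V) :=
    ⟨1 ⊗ₜ v, by simp⟩
  have hT' (v : V) :
      T (-1) ⊗ₜ[A] v - 1 ⊗ₜ ((T (-1) : A[T;T⁻¹]) • v) ∈
        LinearMap.range (characteristicMap (A := A) V) :=
    ⟨-(T (-1) ⊗ₜ ((T (-1) : A[T;T⁻¹]) • v)), by
      rw [map_neg, characteristicMap_tmul, smul_smul, ← T_add, add_neg_cancel, T_zero, one_smul,
        neg_sub]⟩
  induction p using LaurentPolynomial.induction_on generalizing v with
  | h_C a =>
    have h : (C a : A[T;T⁻¹]) = a • 1 := by rw [smul_eq_C_mul, mul_one]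
    rw [h, smul_assoc, one_smul, TensorProduct.smul_tmul, sub_self]
    exact zero_mem _
  | h_add hp hq =>
    convert add_mem (hp v) (hq v) using 1
    rw [TensorProduct.add_tmul, add_smul, TensorProduct.tmul_add]
    abel
  | h_C_mul_T n a h =>
    rw [T_add, ← mul_assoc]
    exact hmul _ _ h hT v
  | h_C_mul_T_Z n a h =>
    rw [T_sub, ← mul_assoc]
    exact hmul _ _ h hT' v

lemma exact_characteristicMap_actionMap :
    Function.Exact (characteristicMap (A := A) V) (actionMap V) := by
  have hcomp : actionMap V ∘ₗ characteristicMap (A := A) V = 0 := by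
    ext v
    simp
  have hsub (z : A[T;T⁻¹] ⊗[A] V) :
      z - 1 ⊗ₜ actionMap V z ∈ LinearMap.range (characteristicMap (A := A) V) := by
    induction z with
    | zero => simp
    | tmul p v => simpa using tmul_sub_one_tmul_smul_mem_range p v
    | add z w hz hw =>
      convert add_mem hz hw using 1
      rw [map_add, TensorProduct.tmul_add]
      abel
  intro z
  refine ⟨fun hz ↦ ?_, ?_⟩
  · simpa [hz] using hsub z
  · rintro ⟨w, rfl⟩
    exact LinearMap.congr_fun hcomp w

lemma tensorCoeff_characteristicMap (z : A[T;T⁻¹] ⊗[A] V) (n : ℤ) :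
    tensorCoeff V (characteristicMap V z) n =
      tensorCoeff V z (n - 1) - (T 1 : A[T;T⁻¹]) • tensorCoeff V z n := by
  induction z with
  | zero => simp
  | tmul p v =>
    have h : (T 1 * p).coeff n = p.coeff (n - 1) := by
      simpa using AddMonoidAlgebra.coeff_single_mul_eq_mul_coeff (r := (1 : A)) (x := p) (m := 1)
        (m₁ := n) (n - 1) (fun m _ ↦ by lia)
    rw [characteristicMap_tmul, map_sub, Finsupp.sub_apply, tensorCoeff_tmul, tensorCoeff_tmul,
      tensorCoeff_tmul, tensorCoeff_tmul, h, smul_comm]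
  | add z w hz hw =>
    simp only [map_add, Finsupp.add_apply, hz, hw, smul_add]
    abel

lemma characteristicMap_injective : Function.Injective (characteristicMap (A := A) V) := by
  rw [injective_iff_map_eq_zero]
  intro z hz
  have hrec (n : ℤ) : tensorCoeff V z (n - 1) = (T 1 : A[T;T⁻¹]) • tensorCoeff V z n := by
    rw [← sub_eq_zero, ← tensorCoeff_characteristicMap, hz]
    simp
  obtain ⟨N, hN⟩ := (tensorCoeff V z).support.bddAbove
  rw [← (tensorCoeff V).map_eq_zero_iff]
  have hzero (n : ℤ) (hn : N < n) : tensorCoeff V z n = 0 := by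
    by_contra h
    exact hn.not_ge (hN (Finsupp.mem_support_iff.2 h))
  have hdown (k : ℕ) : ∀ n : ℤ, N < n + k → tensorCoeff V z n = 0 := by
    induction k with
    | zero => simpa using hzero
    | succ k ih =>
      intro n hn
      have h := hrec (n + 1)
      rwa [add_sub_cancel_right, ih (n + 1) (by push_cast at hn; lia), smul_zero] at h
  ext n
  exact hdown (N + 1 - n).toNat n (by lia)

end CharacteristicSequence

/-- An `A[T;T⁻¹]`-module which is projective over `A` has projective dimension at most `1`. -/
lemma hasProjectiveDimensionLE_one {A V : Type u} [CommRing A] [AddCommGroup V] [Module A V]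
    [Module A[T;T⁻¹] V] [IsScalarTower A A[T;T⁻¹] V] [Module.Projective A V] :
    HasProjectiveDimensionLE (ModuleCat.of A[T;T⁻¹] V) 1 := by
  let S : ShortComplex (ModuleCat A[T;T⁻¹]) :=
    ShortComplex.mk (ModuleCat.ofHom (characteristicMap (A := A) V))
      (ModuleCat.ofHom (actionMap (A := A) V))
      (by
        rw [← ModuleCat.ofHom_comp, (exact_characteristicMap_actionMap V).linearMap_comp_eq_zero]
        rfl)
  have hS : S.ShortExact :=
    { exact := (ShortComplex.ShortExact.moduleCat_exact_iff_function_exact S).2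
        (exact_characteristicMap_actionMap V)
      mono_f := (ModuleCat.mono_iff_injective _).2 (characteristicMap_injective V)
      epi_g := (ModuleCat.epi_iff_surjective _).2 (actionMap_surjective V) }
  have hF : Projective (ModuleCat.of A[T;T⁻¹] (A[T;T⁻¹] ⊗[A] V)) :=
    (IsProjective.iff_projective _).1 inferInstance
  exact hS.hasProjectiveDimensionLT_X₃ 1 (projective_iff_hasProjectiveDimensionLT_one.1 hF)
    (hasProjectiveDimensionLT_of_ge _ 1 2 one_le_two)

end LaurentPolynomial

theorem laurent_ext_two_eq_zero_of_int_free
    (V : Type) [AddCommGroup V] [Module (LaurentPolynomial ℤ) V]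
    (hV : Module.Free ℤ V)
    (W : Type) [AddCommGroup W] [Module (LaurentPolynomial ℤ) W] :
    Subsingleton (Abelian.Ext (ModuleCat.of (LaurentPolynomial ℤ) V)
      (ModuleCat.of (LaurentPolynomial ℤ) W) 2) := by
  have := LaurentPolynomial.hasProjectiveDimensionLE_one (A := ℤ) (V := V)
  exact HasProjectiveDimensionLT.subsingleton _ 2 2 le_rfl _

end
end

section
/- Let X be a finite unique path space. Then the integral incidence algebra ℤ[X] has cohomological dimension at most 2; that is, Ext^n_{ℤ[X]}(V,W) = 0 for all left ℤ[X]-modules V, W and all integers n ≥ 3. -/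
/-!
STATEMENT 13: Let X be a finite unique path space. Then the integral incidence algebra ℤ[X]
has cohomological dimension at most 2; that is, Ext^n_{ℤ[X]}(V,W) = 0 for all left
ℤ[X]-modules V, W and all integers n ≥ 3.
-/

open CategoryTheory

noncomputable section

attribute [local instance] HasDerivedCategory.standard

/-- A finite poset is a unique path space if any two comparable points are connected by a
unique chain of covering relations. -/
def IsUniquePathSpace (X : Type) [PartialOrder X] : Prop :=
  ∀ a b : X, a ≤ b → ∃! l : List X,
    List.Chain (fun u v : X => v ⋖ u) b l ∧
      (b :: l).getLast (List.cons_ne_nil _ _) = a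

theorem Module.Baer.of_surjective_rat {A Q : Type*} [AddCommGroup A] [Module ℚ A] [AddCommGroup Q]
    (f : A →+ Q) (hf : Function.Surjective f) : Module.Baer ℤ Q :=
  have : DivisibleBy A ℤ := divisibleByOfSMulRightSurj A ℤ fun {n} hn a =>
    ⟨(n : ℚ)⁻¹ • a, by
      have hn' : (n : ℚ) ≠ 0 := Int.cast_ne_zero.2 hn
      change n • ((n : ℚ)⁻¹ • a) = a
      rw [← Int.cast_smul_eq_zsmul ℚ, smul_inv_smul₀ hn']⟩
  have : DivisibleBy Q ℤ := hf.divisibleBy (f : A → Q) fun a n => map_zsmul f n a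
  Module.Baer.of_divisible Q

theorem Module.Projective.of_injective_int {K F : Type*} [AddCommGroup K] [AddCommGroup F]
    [Module.Projective ℤ F] (i : K →ₗ[ℤ] F) (hi : Function.Injective i) :
    Module.Projective ℤ K := by
  refine .of_lifting_property'' fun p hp => ?_
  let j : (K →₀ ℤ) →ₗ[ℤ] (K →₀ ℚ) := Finsupp.mapRange.linearMap (Algebra.linearMap ℤ ℚ)
  have hj : Function.Injective j :=
    Finsupp.mapRange_injective _ (map_zero (Algebra.linearMap ℤ ℚ)) Int.cast_injective
  let L := (LinearMap.ker p).map j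
  let κ : K →ₗ[ℤ] (K →₀ ℚ) ⧸ L :=
    (Submodule.mapQ (LinearMap.ker p) L j (Submodule.le_comap_map _ _)).comp
      (p.quotKerEquivOfSurjective hp).symm.toLinearMap
  have hκ (m : K →₀ ℤ) : κ (p m) = L.mkQ (j m) := by
    have : (p.quotKerEquivOfSurjective hp).symm (p m) = (LinearMap.ker p).mkQ m := by
      rw [LinearEquiv.symm_apply_eq]; rfl
    simp only [κ, LinearMap.comp_apply, LinearEquiv.coe_coe, this]
    rfl
  have hB : Module.Baer ℤ ((K →₀ ℚ) ⧸ L) :=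
    .of_surjective_rat L.mkQ.toAddMonoidHom L.mkQ_surjective
  obtain ⟨e, he⟩ := hB.extension_property i hi κ
  obtain ⟨h, hh⟩ := Module.projective_lifting_property L.mkQ e L.mkQ_surjective
  have key (k : K) : ∃ m, j m = h (i k) ∧ p m = k := by
    obtain ⟨m, rfl⟩ := hp k
    have : L.mkQ (h (i (p m))) = L.mkQ (j m) := by
      rw [← hκ, ← he, ← hh]; rfl
    obtain ⟨l, hl, hl'⟩ := (Submodule.Quotient.eq L).1 this
    refine ⟨l + m, ?_, ?_⟩
    · rw [map_add, hl', sub_add_cancel]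
    · rw [map_add, hl, zero_add]
  choose r hr hpr using key
  refine ⟨⟨⟨r, fun a b => hj ?_⟩, fun c a => hj ?_⟩, LinearMap.ext hpr⟩
  · simp [hr]
  · simp [hr]

namespace IsUniquePathSpace

variable {X : Type} [PartialOrder X]

theorem exists_chain [Finite X] {a b : X} (h : a ≤ b) :
    ∃ l : List X, List.IsChain (fun u v : X => v ⋖ u) (b :: l) ∧
      (b :: l).getLast (List.cons_ne_nil _ _) = a := by
  apply List.exists_isChain_cons_of_relationReflTransGen
  induction b using WellFoundedLT.induction with
  | ind b ih =>
    rcases h.eq_or_lt with rfl | h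
    · exact .refl
    · obtain ⟨u, hau, hub⟩ := exists_le_covBy_of_lt h
      exact .head hub (ih u hub.lt hau)

theorem covBy_right_unique [Finite X] (hX : IsUniquePathSpace X) {y u u' x : X}
    (hu : u ⋖ x) (hyu : y ≤ u) (hu' : u' ⋖ x) (hyu' : y ≤ u') : u = u' := by
  obtain ⟨l, hl, hlast⟩ := exists_chain hyu
  obtain ⟨l', hl', hlast'⟩ := exists_chain hyu'
  have := (hX y x (hyu.trans hu.le)).unique
    (y₁ := u :: l) (y₂ := u' :: l')
    ⟨List.isChain_cons_cons.2 ⟨hu, hl⟩, by simpa using hlast⟩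
    ⟨List.isChain_cons_cons.2 ⟨hu', hl'⟩, by simpa using hlast'⟩
  exact (List.cons.inj this).1

theorem covBy_left_unique [Finite X] (hX : IsUniquePathSpace X) {x w w' v : X}
    (hw : x ⋖ w) (hwv : w ≤ v) (hw' : x ⋖ w') (hwv' : w' ≤ v) : w = w' := by
  have key {w : X} (hw : x ⋖ w) {l : List X}
      (hl : List.IsChain (fun u v : X => v ⋖ u) (v :: l))
      (hlast : (v :: l).getLast (List.cons_ne_nil _ _) = w) :
      List.Chain (fun u v : X => v ⋖ u) v (l ++ [x]) ∧
        (v :: (l ++ [x])).getLast (List.cons_ne_nil _ _) = x := by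
    refine ⟨?_, by simp⟩
    change List.IsChain _ ((v :: l) ++ [x])
    refine List.isChain_append.2 ⟨hl, by simp, ?_⟩
    intro a ha b hb
    rw [List.getLast?_eq_getLast_of_ne_nil (List.cons_ne_nil _ _), hlast] at ha
    simp at ha hb
    subst ha hb
    exact hw
  obtain ⟨l, hl, hlast⟩ := exists_chain hwv
  obtain ⟨l', hl', hlast'⟩ := exists_chain hwv'
  have := (hX x v (hw.le.trans hwv)).unique (key hw hl hlast) (key hw' hl' hlast')
  obtain rfl : l = l' := List.append_cancel_right this
  exact hlast.symm.trans hlast'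

end IsUniquePathSpace

namespace IncidenceAlgebra

open scoped Classical in
/-- The matrix unit at `(p, q)`, equal to zero when `p ≤ q` fails. -/
def matrixUnit {X : Type} [PartialOrder X] (p q : X) : IncidenceAlgebra ℤ X where
  toFun a b := if a = p ∧ b = q ∧ p ≤ q then 1 else 0
  eq_zero_of_not_le' a b h := if_neg (by rintro ⟨rfl, rfl, h'⟩; exact h h')

open scoped Classical in
theorem matrixUnit_apply {X : Type} [PartialOrder X] (p q a b : X) :
    matrixUnit p q a b = if a = p ∧ b = q ∧ p ≤ q then 1 else 0 := rfl

section

variable {X : Type} [PartialOrder X] [Fintype X] [LocallyFiniteOrder X] [DecidableEq X]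

omit [Fintype X] [LocallyFiniteOrder X] [DecidableEq X] in
theorem matrixUnit_eq_zero {p q : X} (h : ¬ p ≤ q) : matrixUnit p q = 0 := by
  ext a b _
  simp [matrixUnit_apply, h]

omit [DecidableEq X] in
theorem mul_apply_eq_sum_univ (f g : IncidenceAlgebra ℤ X) (a b : X) :
    (f * g) a b = ∑ x, f a x * g x b := by
  rw [mul_apply]
  refine Finset.sum_subset (Finset.subset_univ _) fun x _ hx => ?_
  rw [Finset.mem_Icc, not_and_or] at hx
  rcases hx with hx | hx <;> simp [apply_eq_zero_of_not_le hx]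

theorem matrixUnit_mul_matrixUnit {p q r : X} (hpq : p ≤ q) (hqr : q ≤ r) :
    matrixUnit p q * matrixUnit q r = matrixUnit p r := by
  ext a b _
  have := hpq.trans hqr
  rw [mul_apply_eq_sum_univ, Finset.sum_eq_single q]
  · simp only [matrixUnit_apply]; split_ifs <;> simp_all
  · intro x _ hx; simp [matrixUnit_apply, hx]
  · simp

theorem matrixUnit_mul_matrixUnit_of_ne {p q q' r : X} (h : q ≠ q') :
    matrixUnit p q * matrixUnit q' r = 0 := by
  ext a b _
  rw [mul_apply_eq_sum_univ]
  refine Finset.sum_eq_zero fun x _ => ?_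
  simp only [matrixUnit_apply]
  split_ifs <;> simp_all

omit [LocallyFiniteOrder X] in
theorem sum_matrixUnit_self : ∑ x : X, matrixUnit x x = 1 := by
  have h (s : Finset X) (a b : X) :
      (∑ x ∈ s, matrixUnit x x) a b = ∑ x ∈ s, matrixUnit x x a b := by
    induction s using Finset.induction_on with
    | empty => rfl
    | insert x s hx ih => rw [Finset.sum_insert hx, Finset.sum_insert hx, add_apply, ih]
  ext a b _
  rw [h, one_apply, Finset.sum_eq_single a]
  · simp [matrixUnit_apply, eq_comm]
  · intro x _ hx; simp [matrixUnit_apply, hx.symm]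
  · simp

theorem matrixUnit_mul_mul (a : IncidenceAlgebra ℤ X) (p q : X) :
    matrixUnit p p * a * matrixUnit q q = a p q • matrixUnit p q := by
  ext u v huv
  simp only [mul_apply_eq_sum_univ]
  rw [constSMul_apply, Finset.sum_eq_single q, Finset.sum_eq_single p]
  · simp only [matrixUnit_apply]
    by_cases hpq : p ≤ q
    · split_ifs <;> simp_all
    · simp [apply_eq_zero_of_not_le hpq]
  · intro x _ hx; simp [matrixUnit_apply, hx]
  · simp
  · intro x _ hx; simp [matrixUnit_apply, hx]
  · simp

theorem eq_sum_matrixUnit (a : IncidenceAlgebra ℤ X) :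
    a = ∑ p, ∑ q, a p q • matrixUnit p q := by
  simp_rw [← matrixUnit_mul_mul, ← Finset.mul_sum, ← Finset.sum_mul, sum_matrixUnit_self,
    one_mul, mul_one]

variable {M N : Type} [AddCommGroup M] [AddCommGroup N]
  [Module (IncidenceAlgebra ℤ X) M] [Module (IncidenceAlgebra ℤ X) N]

theorem map_smul_of_map_matrixUnit_smul (f : M →+ N)
    (h : ∀ p q m, p ≤ q → f ((matrixUnit p q : IncidenceAlgebra ℤ X) • m) = matrixUnit p q • f m)
    (a : IncidenceAlgebra ℤ X) (m : M) : f (a • m) = a • f m := by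
  rw [eq_sum_matrixUnit a]
  simp only [Finset.sum_smul, map_sum]
  refine Finset.sum_congr rfl fun p _ => Finset.sum_congr rfl fun q _ => ?_
  by_cases hpq : p ≤ q
  · have h1 : ∀ (c : ℤ) (b : IncidenceAlgebra ℤ X) {P : Type} [AddCommGroup P]
        [Module (IncidenceAlgebra ℤ X) P] (x : P), (c • b) • x = c • (b • x) :=
      fun c b _ _ _ x => smul_assoc c b x
    rw [h1, h1, map_zsmul, h p q m hpq]
  · simp [matrixUnit_eq_zero hpq]

end

/-- Families of vectors of `K` indexed by `X × ι`, on which the incidence algebra acts by matrix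
multiplication in the variable of `X` (not by its action on `K`). -/
def Column (X ι K : Type) : Type := X → ι → K

namespace Column

variable {X ι K : Type} [AddCommGroup K]

instance : AddCommGroup (Column X ι K) := inferInstanceAs (AddCommGroup (X → ι → K))

@[simp] theorem add_apply (f g : Column X ι K) (y : X) (i : ι) : (f + g) y i = f y i + g y i := rfl

@[simp] theorem zero_apply (y : X) (i : ι) : (0 : Column X ι K) y i = 0 := rfl

variable [PartialOrder X] [Fintype X] [LocallyFiniteOrder X] [DecidableEq X]

instance : SMul (IncidenceAlgebra ℤ X) (Column X ι K) where
  smul a f y i := ∑ z, a y z • f z i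

omit [LocallyFiniteOrder X] [DecidableEq X] in
theorem smul_apply (a : IncidenceAlgebra ℤ X) (f : Column X ι K) (y : X) (i : ι) :
    (a • f) y i = ∑ z, a y z • f z i := rfl

instance : Module (IncidenceAlgebra ℤ X) (Column X ι K) where
  one_smul f := by
    funext y i
    simp [smul_apply, ite_smul]
  mul_smul a b f := by
    funext y i
    simp only [smul_apply, mul_apply_eq_sum_univ, Finset.smul_sum, Finset.sum_smul, mul_smul]
    exact Finset.sum_comm
  smul_zero a := by
    funext y i
    simp [smul_apply]
  smul_add a f g := by
    funext y i
    simp [smul_apply, Finset.sum_add_distrib]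
  add_smul a b f := by
    funext y i
    simp [smul_apply, Finset.sum_add_distrib, add_smul]
  zero_smul f := by
    funext y i
    simp [smul_apply]

omit [LocallyFiniteOrder X] in
open scoped Classical in
theorem matrixUnit_smul_apply {p q : X} (hpq : p ≤ q) (f : Column X ι K) (y : X) (i : ι) :
    ((matrixUnit p q : IncidenceAlgebra ℤ X) • f) y i = if y = p then f q i else 0 := by
  rw [smul_apply, Finset.sum_eq_single q]
  · simp [matrixUnit_apply, hpq]
  · intro x _ hx; simp [matrixUnit_apply, hx]
  · simp

end Column

section Induced

variable {X ι K M : Type} [PartialOrder X] [Fintype X] [LocallyFiniteOrder X] [DecidableEq X]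
  [AddCommGroup K] [Module (IncidenceAlgebra ℤ X) K]
  [AddCommGroup M] [Module (IncidenceAlgebra ℤ X) M]

variable (K) in
/-- For `A` the incidence algebra and `e x` the diagonal idempotents, this is the direct sum over
`i` of the left modules `A e (s i) ⊗ e (t i) K`, the action being that on the left factor. -/
def induced (s t : ι → X) : Submodule (IncidenceAlgebra ℤ X) (Column X ι K) where
  carrier := {g | ∀ y i, (¬ y ≤ s i → g y i = 0) ∧
    (matrixUnit (t i) (t i) : IncidenceAlgebra ℤ X) • g y i = g y i}
  zero_mem' y i := by simp
  add_mem' {f g} hf hg y i := by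
    refine ⟨fun h => ?_, ?_⟩
    · simp [(hf y i).1 h, (hg y i).1 h]
    · rw [Column.add_apply, smul_add, (hf y i).2, (hg y i).2]
  smul_mem' a g hg y i := by
    refine ⟨fun h => ?_, ?_⟩
    · refine Finset.sum_eq_zero fun z _ => ?_
      by_cases hyz : y ≤ z
      · rw [(hg z i).1 fun hz => h (hyz.trans hz), smul_zero]
      · rw [apply_eq_zero_of_not_le hyz, zero_smul]
    · rw [Column.smul_apply, Finset.smul_sum]
      exact Finset.sum_congr rfl fun z _ => by rw [smul_comm, (hg z i).2]

variable {s t : ι → X}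

theorem induced_apply_eq_zero (g : induced K s t) {y : X} {i : ι} (h : ¬ y ≤ s i) :
    g.1 y i = 0 := (g.2 y i).1 h

theorem matrixUnit_smul_induced_apply (g : induced K s t) (y : X) (i : ι) :
    (matrixUnit (t i) (t i) : IncidenceAlgebra ℤ X) • g.1 y i = g.1 y i := (g.2 y i).2

variable [Fintype ι]

/-- The linear map out of an induced module determined by additive maps on the `K`-factors. -/
def inducedLift (s t : ι → X) (ψ : ι → K →+ M) : induced K s t →ₗ[IncidenceAlgebra ℤ X] M :=
  let f : induced K s t →+ M :=
    { toFun g := ∑ y, ∑ i, (matrixUnit y (s i) : IncidenceAlgebra ℤ X) • ψ i (g.1 y i)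
      map_zero' := by simp
      map_add' g h := by simp [Finset.sum_add_distrib] }
  { f with
    map_smul' := by
      refine map_smul_of_map_matrixUnit_smul f fun p q g hpq => ?_
      change ∑ y, ∑ i, (matrixUnit y (s i) : IncidenceAlgebra ℤ X) •
          ψ i (((matrixUnit p q : IncidenceAlgebra ℤ X) • g.1) y i) =
        matrixUnit p q • ∑ y, ∑ i, (matrixUnit y (s i) : IncidenceAlgebra ℤ X) • ψ i (g.1 y i)
      simp only [Finset.smul_sum, ← mul_smul]
      rw [Finset.sum_eq_single p, Finset.sum_eq_single q]
      · refine Finset.sum_congr rfl fun i _ => ?_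
        rw [Column.matrixUnit_smul_apply hpq, if_pos rfl]
        by_cases hq : q ≤ s i
        · rw [matrixUnit_mul_matrixUnit hpq hq]
        · simp [induced_apply_eq_zero g hq]
      · intro y _ hy
        refine Finset.sum_eq_zero fun i _ => ?_
        rw [matrixUnit_mul_matrixUnit_of_ne hy.symm, zero_smul]
      · simp
      · intro y _ hy
        refine Finset.sum_eq_zero fun i _ => ?_
        rw [Column.matrixUnit_smul_apply hpq, if_neg hy, map_zero, smul_zero]
      · simp }

theorem inducedLift_apply (ψ : ι → K →+ M) (g : induced K s t) :
    inducedLift s t ψ g =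
      ∑ y, ∑ i, (matrixUnit y (s i) : IncidenceAlgebra ℤ X) • ψ i (g.1 y i) := rfl

open scoped Classical in
/-- The inclusion `k ↦ e (s i) ⊗ e (t i) k` of generators in an induced module. -/
def inducedSingle (s t : ι → X) (i : ι) : K →+ induced K s t where
  toFun k := ⟨fun y j => if y = s i ∧ j = i then
      (matrixUnit (t i) (t i) : IncidenceAlgebra ℤ X) • k else 0, fun y j => by
    refine ⟨fun h => if_neg ?_, ?_⟩
    · rintro ⟨rfl, rfl⟩; exact h le_rfl
    · dsimp only
      split_ifs with h
      · rw [h.2, ← mul_smul, matrixUnit_mul_matrixUnit le_rfl le_rfl]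
      · exact smul_zero _⟩
  map_zero' := Subtype.ext (funext₂ fun y j => by simp)
  map_add' k l := Subtype.ext (funext₂ fun y j => by
    rw [Submodule.coe_add, Column.add_apply]
    dsimp only
    split_ifs <;> simp)

omit [Fintype ι] in
open scoped Classical in
theorem inducedSingle_apply (i : ι) (k : K) (y : X) (j : ι) :
    (inducedSingle s t i k).1 y j = if y = s i ∧ j = i then
      (matrixUnit (t i) (t i) : IncidenceAlgebra ℤ X) • k else 0 := rfl

theorem inducedLift_inducedSingle (g : induced K s t) :
    inducedLift s t (inducedSingle s t) g = g := by
  ext : 1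
  funext y j
  have hsum {κ : Type} (S : Finset κ) (h : κ → induced K s t) :
      (∑ k ∈ S, h k).1 y j = ∑ k ∈ S, (h k).1 y j := by
    induction S using Finset.cons_induction with
    | empty => simp
    | cons a S ha ih => rw [Finset.sum_cons, Finset.sum_cons, ← ih]; rfl
  rw [inducedLift_apply, hsum, Finset.sum_eq_single y, hsum, Finset.sum_eq_single j]
  · by_cases hy : y ≤ s j
    · rw [Submodule.coe_smul, Column.matrixUnit_smul_apply hy, if_pos rfl, inducedSingle_apply,
        if_pos ⟨rfl, rfl⟩, matrixUnit_smul_induced_apply]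
    · simp [induced_apply_eq_zero g hy]
  · intro i _ hi
    by_cases hy : y ≤ s i
    · rw [Submodule.coe_smul, Column.matrixUnit_smul_apply hy, if_pos rfl, inducedSingle_apply,
        if_neg fun h => hi h.2.symm]
    · simp [induced_apply_eq_zero g hy]
  · simp
  · intro z _ hz
    rw [hsum]
    refine Finset.sum_eq_zero fun i _ => ?_
    by_cases hy : z ≤ s i
    · rw [Submodule.coe_smul, Column.matrixUnit_smul_apply hy, if_neg hz.symm]
    · simp [matrixUnit_eq_zero hy]
  · simp

theorem induced_projective [Module.Projective ℤ K] (s t : ι → X) :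
    Module.Projective (IncidenceAlgebra ℤ X) (induced K s t) := by
  refine .of_lifting_property'' fun p hp => ?_
  choose ψ hψ using fun i => Module.projective_lifting_property
    p.toAddMonoidHom.toIntLinearMap (inducedSingle s t i).toIntLinearMap hp
  refine ⟨inducedLift s t fun i => (ψ i).toAddMonoidHom, LinearMap.ext fun g => ?_⟩
  refine Eq.trans ?_ (inducedLift_inducedSingle g)
  rw [LinearMap.comp_apply, inducedLift_apply, inducedLift_apply, map_sum]
  refine Finset.sum_congr rfl fun y _ => ?_
  rw [map_sum]
  refine Finset.sum_congr rfl fun i _ => ?_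
  rw [map_smul]
  exact congrArg _ (LinearMap.congr_fun (hψ i) _)

end Induced

section Resolution

variable {X K : Type} [PartialOrder X] [Fintype X] [LocallyFiniteOrder X] [DecidableEq X]
  [AddCommGroup K] [Module (IncidenceAlgebra ℤ X) K]

/-- The covering pairs `u ⋖ v` of `X`. -/
abbrev Cover (X : Type) [PartialOrder X] : Type := {c : X × X // c.1 ⋖ c.2}

instance : Fintype (Cover X) := Fintype.ofFinite _

/-- The lower end of a covering pair. -/
abbrev Cover.lower (c : Cover X) : X := c.1.1

/-- The upper end of a covering pair. -/
abbrev Cover.upper (c : Cover X) : X := c.1.2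

variable (K) in
/-- The multiplication map `⨁ x, A e x ⊗ e x K → K`. -/
def augmentation : induced K (id : X → X) id →ₗ[IncidenceAlgebra ℤ X] K :=
  inducedLift id id fun _ => AddMonoidHom.id K

theorem augmentation_apply (f : induced K (id : X → X) id) :
    augmentation K f = ∑ y, ∑ x, (matrixUnit y x : IncidenceAlgebra ℤ X) • f.1 y x := rfl

theorem augmentation_surjective : Function.Surjective (augmentation (X := X) K) := fun k => by
  refine ⟨∑ x, inducedSingle id id x k, ?_⟩
  have h (x : X) : augmentation K (inducedSingle id id x k) =
      (matrixUnit x x : IncidenceAlgebra ℤ X) • k := by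
    rw [augmentation_apply, Finset.sum_eq_single x, Finset.sum_eq_single x]
    · rw [inducedSingle_apply, if_pos ⟨rfl, rfl⟩, ← mul_smul,
        id, matrixUnit_mul_matrixUnit le_rfl le_rfl]
    · intro y _ hy
      rw [inducedSingle_apply, if_neg fun h => hy h.2, smul_zero]
    · simp
    · intro y _ hy
      refine Finset.sum_eq_zero fun z _ => ?_
      rw [inducedSingle_apply, if_neg fun h => hy h.1, smul_zero]
    · simp
  simp_rw [map_sum, h, ← Finset.sum_smul, sum_matrixUnit_self, one_smul]

theorem sum_matrixUnit_smul_eq_zero {f : induced K (id : X → X) id} (hf : augmentation K f = 0)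
    (y : X) : ∑ x, (matrixUnit y x : IncidenceAlgebra ℤ X) • f.1 y x = 0 := by
  have h : (matrixUnit y y : IncidenceAlgebra ℤ X) • augmentation K f = 0 := by
    rw [hf, smul_zero]
  rw [augmentation_apply, Finset.smul_sum, Finset.sum_eq_single y] at h
  · rw [← h, Finset.smul_sum]
    refine Finset.sum_congr rfl fun x _ => ?_
    by_cases hx : y ≤ x
    · rw [← mul_smul, matrixUnit_mul_matrixUnit le_rfl hx]
    · simp [matrixUnit_eq_zero hx]
  · intro z _ hz
    simp_rw [Finset.smul_sum, ← mul_smul, matrixUnit_mul_matrixUnit_of_ne hz.symm, zero_smul,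
      Finset.sum_const_zero]
  · simp

open scoped Classical in
variable (K) in
/-- The differential sending `a ⊗ k` in the summand of a cover `u ⋖ v`
to `a E_{uv} ⊗ k - a ⊗ E_{uv} k`. -/
def differential :
    induced K (Cover.lower (X := X)) Cover.upper →ₗ[IncidenceAlgebra ℤ X]
      induced K (id : X → X) id :=
  let d : induced K (Cover.lower (X := X)) Cover.upper →+ induced K (id : X → X) id :=
    { toFun g := ⟨fun y x => (∑ c : Cover X, if c.upper = x then g.1 y c else 0) -
          ∑ c : Cover X, if c.lower = x then
            (matrixUnit x c.upper : IncidenceAlgebra ℤ X) • g.1 y c else 0, fun y x => by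
        refine ⟨fun h => ?_, ?_⟩
        · dsimp only
          rw [Finset.sum_eq_zero, Finset.sum_eq_zero, sub_zero]
          · rintro c -
            split_ifs with hc
            · rw [induced_apply_eq_zero g fun h' => h (h'.trans hc.le), smul_zero]
            · rfl
          · rintro c -
            split_ifs with hc
            · exact induced_apply_eq_zero g fun h' => h (h'.trans (c.2.le.trans hc.le))
            · rfl
        · dsimp only
          rw [smul_sub, Finset.smul_sum, Finset.smul_sum]
          congr 1
          · refine Finset.sum_congr rfl fun c _ => ?_
            split_ifs with hc
            · subst hc
              exact matrixUnit_smul_induced_apply g y c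
            · exact smul_zero _
          · refine Finset.sum_congr rfl fun c _ => ?_
            split_ifs with hc
            · subst hc
              rw [← mul_smul]
              exact congrArg (· • g.1 y c) (matrixUnit_mul_matrixUnit le_rfl c.2.le)
            · exact smul_zero _⟩
      map_zero' := Subtype.ext (funext₂ fun y x => by simp)
      map_add' g h := Subtype.ext (funext₂ fun y x => by
        simp only [Submodule.coe_add, Column.add_apply, smul_add]
        refine Eq.trans ?_ (sub_add_sub_comm _ _ _ _).symm
        rw [← Finset.sum_add_distrib, ← Finset.sum_add_distrib]
        congr 1 <;> refine Finset.sum_congr rfl fun c _ => ?_ <;> split_ifs <;> simp) }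
  { d with
    map_smul' := by
      refine map_smul_of_map_matrixUnit_smul d fun p q g hpq => Subtype.ext (funext₂ fun y x => ?_)
      rw [Submodule.coe_smul, Column.matrixUnit_smul_apply hpq]
      simp only [d, AddMonoidHom.coe_mk, ZeroHom.coe_mk, Submodule.coe_smul,
        Column.matrixUnit_smul_apply hpq]
      split_ifs <;> simp }

open scoped Classical in
theorem differential_apply (g : induced K (Cover.lower (X := X)) Cover.upper) (y x : X) :
    (differential K g).1 y x = (∑ c : Cover X, if c.upper = x then g.1 y c else 0) -
      ∑ c : Cover X, if c.lower = x then
        (matrixUnit x c.upper : IncidenceAlgebra ℤ X) • g.1 y c else 0 := rfl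

theorem augmentation_differential (g : induced K (Cover.lower (X := X)) Cover.upper) :
    augmentation K (differential K g) = 0 := by
  rw [augmentation_apply]
  refine Finset.sum_eq_zero fun y _ => ?_
  simp_rw [differential_apply, smul_sub, Finset.smul_sum, Finset.sum_sub_distrib]
  rw [sub_eq_zero, Finset.sum_comm]
  conv_rhs => rw [Finset.sum_comm]
  refine Finset.sum_congr rfl fun c _ => ?_
  simp only [smul_ite, smul_zero, Finset.sum_ite_eq, Finset.mem_univ, if_true]
  by_cases hy : y ≤ c.lower
  · rw [← mul_smul, matrixUnit_mul_matrixUnit hy c.2.le]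
  · rw [induced_apply_eq_zero g hy, smul_zero, smul_zero, smul_zero]

theorem differential_injective (hX : IsUniquePathSpace X) :
    Function.Injective (differential (X := X) K) := by
  rw [injective_iff_map_eq_zero]
  intro g hg
  have key (y x : X) : ∀ c : Cover X, c.upper = x → g.1 y c = 0 := by
    induction x using WellFoundedGT.induction with
    | ind x ih =>
      intro c hc
      by_cases hy : y ≤ c.lower
      · have h := differential_apply g y x
        rw [hg, Finset.sum_eq_single c, if_pos hc, Finset.sum_eq_zero, sub_zero] at h
        · exact h.symm
        · rintro c' -
          split_ifs with hc'
          · rw [ih c'.upper (hc' ▸ c'.2.lt) c' rfl, smul_zero]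
          · rfl
        · rintro c' - hne
          split_ifs with hc'
          · refine induced_apply_eq_zero g fun hy' => hne (Subtype.ext (Prod.ext ?_ ?_))
            · exact hX.covBy_right_unique (x := x) (hc' ▸ c'.2) hy' (hc ▸ c.2) hy
            · exact hc'.trans hc.symm
          · rfl
        · simp
      · exact induced_apply_eq_zero g hy
  exact Subtype.ext (funext₂ fun y c => key y _ c rfl)

open scoped Classical in
omit [Module (IncidenceAlgebra ℤ X) K] in
theorem sum_cover_lower (hX : IsUniquePathSpace X) (x v : X) (k : K) :
    (∑ c : Cover X, if c.lower = x then if c.upper ≤ v then k else 0 else 0) =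
      if x < v then k else 0 := by
  split_ifs with hxv
  · obtain ⟨w, hw, hwv⟩ := exists_covBy_le_of_lt hxv
    rw [Finset.sum_eq_single ⟨(x, w), hw⟩, if_pos rfl, if_pos hwv]
    · rintro c - hne
      split_ifs with h1 h2
      · exact absurd (Subtype.ext (Prod.ext h1 (hX.covBy_left_unique (h1 ▸ c.2) h2 hw hwv))) hne
      all_goals rfl
    · simp
  · refine Finset.sum_eq_zero fun c _ => ?_
    split_ifs with h1 h2
    · exact absurd (h1 ▸ c.2.lt.trans_le h2) hxv
    all_goals rfl

open scoped Classical in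
omit [Module (IncidenceAlgebra ℤ X) K] in
theorem sum_cover_upper (hX : IsUniquePathSpace X) (y x : X) (k : K) :
    (∑ c : Cover X, if c.upper = x then if y ≤ c.lower then k else 0 else 0) =
      if y < x then k else 0 := by
  split_ifs with hyx
  · obtain ⟨u, hyu, hu⟩ := exists_le_covBy_of_lt hyx
    rw [Finset.sum_eq_single ⟨(u, x), hu⟩, if_pos rfl, if_pos hyu]
    · rintro c - hne
      split_ifs with h1 h2
      · exact absurd (Subtype.ext (Prod.ext (hX.covBy_right_unique (h1 ▸ c.2) h2 hu hyu) h1)) hne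
      all_goals rfl
    · simp
  · refine Finset.sum_eq_zero fun c _ => ?_
    split_ifs with h1 h2
    · exact absurd (h1 ▸ h2.trans_lt c.2.lt) hyx
    all_goals rfl

open scoped Classical in
theorem exists_differential_eq (hX : IsUniquePathSpace X) {f : induced K (id : X → X) id}
    (hf : augmentation K f = 0) :
    ∃ g, differential K g = f := by
  let S (y x : X) : K := ∑ v, (matrixUnit x v : IncidenceAlgebra ℤ X) • f.1 y v
  have hS (y p x : X) (hpx : p ≤ x) : (matrixUnit p x : IncidenceAlgebra ℤ X) • S y x =
      ∑ v, if x ≤ v then (matrixUnit p v : IncidenceAlgebra ℤ X) • f.1 y v else 0 := by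
    rw [Finset.smul_sum]
    refine Finset.sum_congr rfl fun v _ => ?_
    split_ifs with hxv
    · rw [← mul_smul, matrixUnit_mul_matrixUnit hpx hxv]
    · rw [matrixUnit_eq_zero hxv, zero_smul, smul_zero]
  let g : induced K (Cover.lower (X := X)) Cover.upper :=
    ⟨fun y c => if y ≤ c.lower then S y c.upper else 0, fun y c => by
      refine ⟨fun h => if_neg h, ?_⟩
      dsimp only
      split_ifs
      · rw [hS _ _ _ le_rfl]
        refine Finset.sum_congr rfl fun v _ => ?_
        split_ifs with h
        · rfl
        · rw [matrixUnit_eq_zero h, zero_smul]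
      · exact smul_zero _⟩
  refine ⟨g, Subtype.ext (funext₂ fun y x => ?_)⟩
  have h1 : (∑ c : Cover X, if c.upper = x then g.1 y c else 0) = if y < x then S y x else 0 := by
    rw [← sum_cover_upper hX]
    refine Finset.sum_congr rfl fun c _ => ?_
    split_ifs with hc hy
    · subst hc; exact if_pos hy
    · exact if_neg hy
    · rfl
  have h2 (hyx : y ≤ x) : (∑ c : Cover X, if c.lower = x then
      (matrixUnit x c.upper : IncidenceAlgebra ℤ X) • g.1 y c else 0) = S y x - f.1 y x := by
    calc
      _ = ∑ c : Cover X, ∑ v, if c.lower = x then if c.upper ≤ v then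
          (matrixUnit x v : IncidenceAlgebra ℤ X) • f.1 y v else 0 else 0 := by
        refine Finset.sum_congr rfl fun c _ => ?_
        split_ifs with hc
        · rw [← hS y x c.upper (hc ▸ c.2.le)]
          exact congrArg _ (if_pos (hc ▸ hyx))
        · simp
      _ = ∑ v, if x < v then (matrixUnit x v : IncidenceAlgebra ℤ X) • f.1 y v else 0 := by
        rw [Finset.sum_comm]
        exact Finset.sum_congr rfl fun v _ => sum_cover_lower hX x v _
      _ = S y x - f.1 y x := by
        have hx : f.1 y x = ∑ v, if v = x then
            (matrixUnit x v : IncidenceAlgebra ℤ X) • f.1 y v else 0 := by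
          rw [Finset.sum_ite_eq' , if_pos (Finset.mem_univ _)]
          exact (matrixUnit_smul_induced_apply f y x).symm
        rw [eq_sub_iff_add_eq, hx, ← Finset.sum_add_distrib]
        refine Finset.sum_congr rfl fun v _ => ?_
        by_cases hxv : x ≤ v
        · rcases hxv.eq_or_lt with rfl | hlt
          · simp
          · simp [hlt, hlt.ne']
        · simp [matrixUnit_eq_zero hxv]
  rw [differential_apply, h1]
  by_cases hyx : y ≤ x
  · rw [h2 hyx]
    rcases hyx.eq_or_lt with rfl | hlt
    · rw [if_neg (lt_irrefl _), show S y y = 0 from sum_matrixUnit_smul_eq_zero hf y]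
      simp
    · rw [if_pos hlt, sub_sub_cancel]
  · rw [if_neg fun h => hyx h.le, Finset.sum_eq_zero, sub_zero]
    · exact (induced_apply_eq_zero f hyx).symm
    · rintro c -
      split_ifs with hc
      · rw [induced_apply_eq_zero g fun h => hyx (hc ▸ h), smul_zero]
      · rfl

theorem hasProjectiveDimensionLT_two_of_projective_int (hX : IsUniquePathSpace X)
    [Module.Projective ℤ K] :
    HasProjectiveDimensionLT (ModuleCat.of (IncidenceAlgebra ℤ X) K) 2 := by
  let S : ShortComplex (ModuleCat.{0} (IncidenceAlgebra ℤ X)) :=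
    ShortComplex.moduleCatMk (differential K) (augmentation K)
      (LinearMap.ext augmentation_differential)
  have hS : S.ShortExact := ModuleCat.shortComplex_shortExact S
    (fun f => ⟨fun hf => exists_differential_eq hX hf,
      by rintro ⟨g, rfl⟩; exact augmentation_differential g⟩)
    (differential_injective hX) augmentation_surjective
  have := induced_projective (K := K) (Cover.lower (X := X)) Cover.upper
  have := induced_projective (K := K) (id : X → X) id
  have h₁ : Projective S.X₁ := (IsProjective.iff_projective _).1 ‹_›
  have h₂ : Projective S.X₂ := (IsProjective.iff_projective _).1 ‹_›
  exact hS.hasProjectiveDimensionLT_X₃ 1 inferInstance inferInstance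

end Resolution

theorem projective_int_submodule_finsupp {X : Type} [PartialOrder X] [Finite X]
    [LocallyFiniteOrder X] [DecidableEq X] (V : Type)
    (P : Submodule (IncidenceAlgebra ℤ X) (V →₀ IncidenceAlgebra ℤ X)) :
    Module.Projective ℤ P := by
  let f : P →+ (V →₀ (X × X →₀ ℤ)) :=
    (Finsupp.mapRange.addMonoidHom
      { toFun a := Finsupp.equivFunOnFinite.symm fun p => a p.1 p.2
        map_zero' := by ext; simp
        map_add' a b := by ext; simp }).comp P.subtype.toAddMonoidHom
  have hf : Function.Injective f.toIntLinearMap := by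
    intro a b hab
    refine Subtype.ext (Finsupp.ext fun v => ?_)
    ext p q _
    exact DFunLike.congr_fun (DFunLike.congr_fun hab v) (p, q)
  exact .of_injective_int f.toIntLinearMap hf

end IncidenceAlgebra

theorem ModuleCat.hasProjectiveDimensionLT_succ_of_ker {A V : Type} [Ring A] [AddCommGroup V]
    [Module A V] (n : ℕ) (h : HasProjectiveDimensionLT
      (ModuleCat.of A (LinearMap.ker (Finsupp.linearCombination A (id : V → V)))) (n + 1)) :
    HasProjectiveDimensionLT (ModuleCat.of A V) (n + 2) := by
  let p := Finsupp.linearCombination A (id : V → V)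
  let S : ShortComplex (ModuleCat.{0} A) :=
    ShortComplex.mk (ModuleCat.ofHom (X := LinearMap.ker p) (Y := V →₀ A) (LinearMap.ker p).subtype)
      (ModuleCat.ofHom p)
      (ModuleCat.hom_ext (LinearMap.ext fun x => x.2))
  have hS : S.ShortExact := ModuleCat.shortComplex_shortExact S
    (fun f => ⟨fun hf => ⟨⟨f, hf⟩, rfl⟩, by rintro ⟨g, rfl⟩; exact g.2⟩)
    (LinearMap.ker p).injective_subtype
    (Finsupp.linearCombination_surjective _ Function.surjective_id)
  have h₂ : Projective S.X₂ := (IsProjective.iff_projective _).1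
    (inferInstanceAs (Module.Projective A (V →₀ A)))
  exact hS.hasProjectiveDimensionLT_X₃ (n + 1) h inferInstance

theorem incidence_algebra_global_dimension_le_two
    (X : Type) [PartialOrder X] [Fintype X] [LocallyFiniteOrder X] [DecidableEq X]
    (hX : IsUniquePathSpace X)
    (V W : Type) [AddCommGroup V] [AddCommGroup W]
    [Module (IncidenceAlgebra ℤ X) V] [Module (IncidenceAlgebra ℤ X) W]
    (n : ℕ) (hn : 3 ≤ n) :
    Subsingleton (Abelian.Ext (ModuleCat.of (IncidenceAlgebra ℤ X) V)
      (ModuleCat.of (IncidenceAlgebra ℤ X) W) n) := by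
  have := IncidenceAlgebra.projective_int_submodule_finsupp V
    (LinearMap.ker (Finsupp.linearCombination (IncidenceAlgebra ℤ X) (id : V → V)))
  have := ModuleCat.hasProjectiveDimensionLT_succ_of_ker (A := IncidenceAlgebra ℤ X) (V := V) 1
    (IncidenceAlgebra.hasProjectiveDimensionLT_two_of_projective_int hX)
  exact HasProjectiveDimensionLT.subsingleton _ 3 n hn _

end
end

section
/- Let X = {a, b} be the two-element poset with a ≺ b (the Sierpiński space), and let V and W be left ℤ[X]-modules with structure maps φ : V_b → V_a and ψ : W_b → W_a given by left multiplication by f_{a⪯b}. Then there is an isomorphism Ext²_{ℤ[X]}(V, W) ≅ Ext¹_ℤ(ker φ, coker ψ). -/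
/-!
STATEMENT 15: Let X = {a, b} be the two-element poset with a ≺ b (the Sierpiński space),
and let V and W be left ℤ[X]-modules with structure maps φ : V_b → V_a and ψ : W_b → W_a
given by left multiplication by f_{a⪯b}. Then there is an isomorphism
Ext²_{ℤ[X]}(V, W) ≅ Ext¹_ℤ(ker φ, coker ψ).
Here X is realised as `Fin 2` with a = 0 and b = 1.
-/

open CategoryTheory

noncomputable section
set_option linter.unusedSectionVars false

attribute [local instance] HasDerivedCategory.standard

section Defs

variable {X : Type} [PartialOrder X] [LocallyFiniteOrder X] [DecidableEq X]

/-- The basis element `f_{x⪯y}` of the integral incidence algebra `ℤ[X]`. -/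
def ups (x y : X) (h : x ≤ y) : IncidenceAlgebra ℤ X :=
  ⟨fun a b => if a = x ∧ b = y then 1 else 0, fun a b hab =>
    if_neg (by rintro ⟨rfl, rfl⟩; exact hab h)⟩

lemma ups_mul_ups (x y z : X) (h1 : x ≤ y) (h2 : y ≤ z) :
    ups x y h1 * ups y z h2 = ups x z (h1.trans h2) := by
  ext a b hab
  rw [IncidenceAlgebra.mul_apply]
  show (∑ c ∈ Finset.Icc a b,
    (if a = x ∧ c = y then (1 : ℤ) else 0) * (if c = y ∧ b = z then 1 else 0)) =
    if a = x ∧ b = z then 1 else 0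
  rcases eq_or_ne a x with rfl | ha
  · rcases eq_or_ne b z with rfl | hb
    · rw [Finset.sum_eq_single y]
      · simp
      · intro c _ hcy
        simp [hcy]
      · intro hy
        exact absurd (Finset.mem_Icc.2 ⟨h1, h2⟩) hy
    · simp only [hb, and_false, if_false]
      apply Finset.sum_eq_zero
      intro c _
      rcases eq_or_ne c y with rfl | hcy
      · simp [hb]
      · simp [hcy]
  · simp only [ha, false_and, if_false]
    apply Finset.sum_eq_zero
    intro c _
    simp [ha]

/-- The idempotent `e_x = f_{x⪯x}` of `ℤ[X]`. -/
def eIdem (x : X) : IncidenceAlgebra ℤ X := ups x x le_rfl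

variable (V : Type) [AddCommGroup V] [Module (IncidenceAlgebra ℤ X) V]

/-- The abelian group `V_x = e_x·V` attached to a left `ℤ[X]`-module `V`. -/
def eSub (x : X) : Submodule ℤ V :=
  LinearMap.range (DistribMulAction.toAddMonoidHom V (eIdem x)).toIntLinearMap

lemma ups_smul_mem_eSub (x y : X) (h : x ≤ y) (v : V) :
    ups x y h • v ∈ eSub V x := by
  refine ⟨ups x y h • v, ?_⟩
  show eIdem x • (ups x y h • v) = ups x y h • v
  rw [smul_smul, eIdem, ups_mul_ups]

/-- The structure map `V_y → V_x`, `v ↦ f_{x⪯y}·v`, for `x ≤ y`. -/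
def upsSmul (x y : X) (h : x ≤ y) : eSub V y →ₗ[ℤ] eSub V x :=
  LinearMap.restrict (DistribMulAction.toAddMonoidHom V (ups x y h)).toIntLinearMap
    (fun v _ => ups_smul_mem_eSub V x y h v)

end Defs

section ExtDimensionShift

open Abelian

universe w v u

variable {C : Type u} [Category.{v} C] [Abelian C] [HasExt.{w} C]
  {S : ShortComplex C} (hS : S.ShortExact)

include hS in
lemma precomp_f_bijective (Y : C) (n : ℕ) [Subsingleton (Ext S.X₃ Y n)]
    [Subsingleton (Ext S.X₃ Y (1 + n))] :
    Function.Bijective ((Ext.mk₀ S.f).precomp Y (zero_add n)) := by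
  refine ⟨(injective_iff_map_eq_zero _).2 fun x hx => ?_, fun x => ?_⟩
  · obtain ⟨y, rfl⟩ := Ext.contravariant_sequence_exact₂ hS Y x hx
    rw [Subsingleton.elim y 0, Ext.comp_zero]
  · exact Ext.contravariant_sequence_exact₁ hS Y x rfl (Subsingleton.elim _ _)

include hS in
lemma postcomp_g_bijective (X : C) (n : ℕ) [Subsingleton (Ext X S.X₁ n)]
    [Subsingleton (Ext X S.X₁ (n + 1))] :
    Function.Bijective ((Ext.mk₀ S.g).postcomp X (add_zero n)) := by
  refine ⟨(injective_iff_map_eq_zero _).2 fun x hx => ?_, fun x => ?_⟩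
  · obtain ⟨y, rfl⟩ := Ext.covariant_sequence_exact₂ X hS x hx
    rw [Subsingleton.elim y 0, Ext.zero_comp]
  · exact Ext.covariant_sequence_exact₃ X hS x rfl (Subsingleton.elim _ _)

lemma extClass_precomp_bijective (Y : C) (n : ℕ) [Subsingleton (Ext S.X₂ Y n)]
    [Subsingleton (Ext S.X₂ Y (1 + n))] :
    Function.Bijective (hS.extClass.precomp Y (rfl : 1 + n = 1 + n)) := by
  refine ⟨(injective_iff_map_eq_zero _).2 fun x hx => ?_, fun x => ?_⟩
  · obtain ⟨y, rfl⟩ := Ext.contravariant_sequence_exact₁ hS Y x rfl hx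
    rw [Subsingleton.elim y 0, Ext.comp_zero]
  · exact Ext.contravariant_sequence_exact₃ hS Y x (Subsingleton.elim _ _) rfl

/-- `Ext` groups of isomorphic objects are isomorphic. -/
def extAddEquivOfIso {X X' Y Y' : C} (e : X ≅ X') (e' : Y ≅ Y') (n : ℕ) :
    Ext X Y n ≃+ Ext X' Y' n :=
  ((((extFunctor n).mapIso e.symm.op).app Y) ≪≫
    (extFunctorObj X' n).mapIso e').addCommGroupIsoToAddEquiv

end ExtDimensionShift

section SierpinskiReps

/-- The integral incidence algebra of the Sierpiński space. -/
abbrev SierpinskiAlgebra : Type := IncidenceAlgebra ℤ (Fin 2)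

/-- The basis element `f_{a⪯b}` of the incidence algebra of the Sierpiński space. -/
def arrowElt : SierpinskiAlgebra := ups 0 1 (by decide : (0 : Fin 2) ≤ 1)

namespace SierpinskiAlgebra

lemma mul_apply_zero_zero (r s : SierpinskiAlgebra) : (r * s) 0 0 = r 0 0 * s 0 0 := by
  simp [IncidenceAlgebra.mul_apply]

lemma mul_apply_one_one (r s : SierpinskiAlgebra) : (r * s) 1 1 = r 1 1 * s 1 1 := by
  simp [IncidenceAlgebra.mul_apply]

lemma mul_apply_zero_one (r s : SierpinskiAlgebra) :
    (r * s) 0 1 = r 0 0 * s 0 1 + r 0 1 * s 1 1 := by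
  rw [IncidenceAlgebra.mul_apply, show Finset.Icc (0 : Fin 2) 1 = {0, 1} by decide,
    Finset.sum_pair (by decide)]

lemma eq_sum (r : SierpinskiAlgebra) :
    r = r 0 0 • eIdem 0 + r 0 1 • arrowElt + r 1 1 • eIdem 1 := by
  ext x y hxy
  show r x y = r 0 0 * (if x = 0 ∧ y = 0 then 1 else 0) +
    r 0 1 * (if x = 0 ∧ y = 1 then 1 else 0) + r 1 1 * (if x = 1 ∧ y = 1 then 1 else 0)
  fin_cases x <;> fin_cases y <;> simp at hxy ⊢

lemma ups_mul_ups_of_ne {x y y' z : Fin 2} (h : x ≤ y) (h' : y' ≤ z) (hy : y ≠ y') :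
    ups x y h * ups y' z h' = 0 := by
  ext a b hab
  rw [IncidenceAlgebra.mul_apply]
  refine Finset.sum_eq_zero fun c _ => ?_
  show (if a = x ∧ c = y then (1 : ℤ) else 0) * (if c = y' ∧ b = z then 1 else 0) = 0
  grind

lemma eIdem_zero_add_eIdem_one : (eIdem 0 + eIdem 1 : SierpinskiAlgebra) = 1 := by
  rw [eq_sum 1]
  simp

variable {M : Type} [AddCommGroup M] [Module SierpinskiAlgebra M]

lemma smul_eq (r : SierpinskiAlgebra) (m : M) :
    r • m = r 0 0 • (eIdem (0 : Fin 2) • m) + r 0 1 • (arrowElt • m)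
      + r 1 1 • (eIdem (1 : Fin 2) • m) := by
  have key (n : ℤ) (s : SierpinskiAlgebra) : (n • s) • m = n • (s • m) :=
    map_zsmul ((smulAddHom SierpinskiAlgebra M).flip m) n s
  conv_lhs => rw [eq_sum r]
  rw [add_smul, add_smul, key, key, key]

lemma eIdem_smul_eIdem_smul (x : Fin 2) (m : M) : eIdem x • eIdem x • m = eIdem x • m := by
  rw [smul_smul, eIdem, ups_mul_ups]

lemma eIdem_zero_smul_eIdem_one_smul (m : M) :
    eIdem (0 : Fin 2) • eIdem (1 : Fin 2) • m = 0 := by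
  rw [smul_smul, eIdem, eIdem, ups_mul_ups_of_ne _ _ (by decide), zero_smul]

lemma eIdem_one_smul_eIdem_zero_smul (m : M) :
    eIdem (1 : Fin 2) • eIdem (0 : Fin 2) • m = 0 := by
  rw [smul_smul, eIdem, eIdem, ups_mul_ups_of_ne _ _ (by decide), zero_smul]

lemma eIdem_zero_smul_arrowElt_smul (m : M) :
    eIdem (0 : Fin 2) • arrowElt • m = arrowElt • m := by
  rw [smul_smul, eIdem, arrowElt, ups_mul_ups]

lemma arrowElt_smul_eIdem_one_smul (m : M) :
    arrowElt • eIdem (1 : Fin 2) • m = arrowElt • m := by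
  rw [smul_smul, eIdem, arrowElt, ups_mul_ups]

lemma eIdem_one_smul_arrowElt_smul (m : M) : eIdem (1 : Fin 2) • arrowElt • m = 0 := by
  rw [smul_smul, eIdem, arrowElt, ups_mul_ups_of_ne _ _ (by decide), zero_smul]

lemma arrowElt_smul_eIdem_zero_smul (m : M) : arrowElt • eIdem (0 : Fin 2) • m = 0 := by
  rw [smul_smul, eIdem, arrowElt, ups_mul_ups_of_ne _ _ (by decide)]
  exact zero_smul SierpinskiAlgebra m

/-- Additive maps compatible with the three basis elements are linear over the algebra. -/
def linearMapOfBasis {N : Type} [AddCommGroup N] [Module SierpinskiAlgebra N] (f : M →+ N)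
    (h₀ : ∀ m, f (eIdem (0 : Fin 2) • m) = eIdem (0 : Fin 2) • f m)
    (h₁ : ∀ m, f (eIdem (1 : Fin 2) • m) = eIdem (1 : Fin 2) • f m)
    (h : ∀ m, f (arrowElt • m) = arrowElt • f m) : M →ₗ[SierpinskiAlgebra] N where
  __ := f
  map_smul' r m := by
    show f (r • m) = r • f m
    rw [smul_eq r m, smul_eq r (f m)]
    simp only [map_add, map_zsmul, h₀, h₁, h]

/-- The character `f ↦ f 0 0` of the incidence algebra. -/
def evalZero : SierpinskiAlgebra →+* ℤ where
  toFun r := r 0 0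
  map_one' := by simp
  map_mul' := mul_apply_zero_zero
  map_zero' := rfl
  map_add' _ _ := rfl

end SierpinskiAlgebra

open SierpinskiAlgebra

variable {A B A₁ B₁ A₂ B₂ A₃ B₃ : Type}
  [AddCommGroup A] [AddCommGroup B] [AddCommGroup A₁] [AddCommGroup B₁]
  [AddCommGroup A₂] [AddCommGroup B₂] [AddCommGroup A₃] [AddCommGroup B₃]

/-- The module over the incidence algebra with structure map `φ : B → A`. -/
def ArrowRep (_ : B →ₗ[ℤ] A) : Type := B × A

namespace ArrowRep

variable (φ : B →ₗ[ℤ] A)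

instance : AddCommGroup (ArrowRep φ) := inferInstanceAs (AddCommGroup (B × A))

@[ext]
lemma ext {φ : B →ₗ[ℤ] A} {x y : ArrowRep φ} (h₁ : x.1 = y.1) (h₂ : x.2 = y.2) : x = y :=
  Prod.ext h₁ h₂

@[simp] lemma add_fst (x y : ArrowRep φ) : (x + y).1 = x.1 + y.1 := rfl
@[simp] lemma add_snd (x y : ArrowRep φ) : (x + y).2 = x.2 + y.2 := rfl
@[simp] lemma zero_fst : (0 : ArrowRep φ).1 = 0 := rfl
@[simp] lemma zero_snd : (0 : ArrowRep φ).2 = 0 := rfl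

instance : SMul SierpinskiAlgebra (ArrowRep φ) where
  smul r x := (r 1 1 • x.1, r 0 0 • x.2 + r 0 1 • φ x.1)

@[simp] lemma smul_fst (r : SierpinskiAlgebra) (x : ArrowRep φ) : (r • x).1 = r 1 1 • x.1 := rfl

@[simp] lemma smul_snd (r : SierpinskiAlgebra) (x : ArrowRep φ) :
    (r • x).2 = r 0 0 • x.2 + r 0 1 • φ x.1 := rfl

instance : Module SierpinskiAlgebra (ArrowRep φ) where
  one_smul x := by ext <;> simp
  mul_smul r s x := by
    ext
    · simp only [smul_fst, mul_apply_one_one, mul_smul]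
    · simp only [smul_fst, smul_snd, mul_apply_zero_zero, mul_apply_zero_one, map_smul]
      module
  smul_zero r := by ext <;> simp
  smul_add r x y := by
    ext
    · simp
    · simp only [smul_snd, add_fst, add_snd, map_add]
      module
  add_smul r s x := by
    ext
    · simp only [smul_fst, add_fst, IncidenceAlgebra.add_apply, add_smul]
    · simp only [smul_snd, add_snd, IncidenceAlgebra.add_apply]
      module
  zero_smul x := by ext <;> simp

@[simp] lemma eIdem_zero_smul (x : ArrowRep φ) :
    eIdem (0 : Fin 2) • x = ((0, x.2) : B × A) :=
  ext (zero_smul ℤ x.1) (by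
    rw [smul_snd]
    show (1 : ℤ) • x.2 + (0 : ℤ) • φ x.1 = x.2
    simp)

@[simp] lemma eIdem_one_smul (x : ArrowRep φ) :
    eIdem (1 : Fin 2) • x = ((x.1, 0) : B × A) :=
  ext (one_smul ℤ x.1) (by
    rw [smul_snd]
    show (0 : ℤ) • x.2 + (0 : ℤ) • φ x.1 = 0
    simp)

@[simp] lemma arrowElt_smul (x : ArrowRep φ) : arrowElt • x = ((0, φ x.1) : B × A) :=
  ext (zero_smul ℤ x.1) (by
    rw [smul_snd]
    show (0 : ℤ) • x.2 + (1 : ℤ) • φ x.1 = φ x.1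
    simp)

variable {φ} {φ₁ : B₁ →ₗ[ℤ] A₁} {φ₂ : B₂ →ₗ[ℤ] A₂} {φ₃ : B₃ →ₗ[ℤ] A₃}
variable {M : Type} [AddCommGroup M] [Module SierpinskiAlgebra M]

/-- The morphism of representations given by a commutative square. -/
def map (β : B₁ →ₗ[ℤ] B₂) (α : A₁ →ₗ[ℤ] A₂) (h : ∀ b, φ₂ (β b) = α (φ₁ b)) :
    ArrowRep φ₁ →ₗ[SierpinskiAlgebra] ArrowRep φ₂ where
  toFun x := ((β x.1, α x.2) : B₂ × A₂)
  map_add' x y := ext (map_add β _ _) (map_add α _ _)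
  map_smul' r x := ext (map_smul β _ _) (by
    show α (r • x).2 = r 0 0 • α x.2 + r 0 1 • φ₂ (β x.1)
    simp [h])

/-- Maps out of a representation. -/
def desc (β : B →ₗ[ℤ] M) (α : A →ₗ[ℤ] M) (hβ : ∀ b, eIdem (1 : Fin 2) • β b = β b)
    (hα : ∀ a, eIdem (0 : Fin 2) • α a = α a) (h : ∀ b, arrowElt • β b = α (φ b)) :
    ArrowRep φ →ₗ[SierpinskiAlgebra] M :=
  linearMapOfBasis
    { toFun x := β x.1 + α x.2
      map_zero' := by simp
      map_add' x y := by simp only [add_fst, add_snd, map_add]; abel }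
    (fun x => by
      show β (eIdem (0 : Fin 2) • x).1 + α (eIdem (0 : Fin 2) • x).2 = _ • (β x.1 + α x.2)
      rw [eIdem_zero_smul, smul_add, hα, ← hβ, ← hβ x.1, eIdem_zero_smul_eIdem_one_smul]
      simp)
    (fun x => by
      show β (eIdem (1 : Fin 2) • x).1 + α (eIdem (1 : Fin 2) • x).2 = _ • (β x.1 + α x.2)
      rw [eIdem_one_smul, smul_add, hβ, ← hα x.2, eIdem_one_smul_eIdem_zero_smul]
      simp)
    (fun x => by
      show β (arrowElt • x).1 + α (arrowElt • x).2 = _ • (β x.1 + α x.2)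
      rw [arrowElt_smul, smul_add, h, ← hα x.2, arrowElt_smul_eIdem_zero_smul]
      simp)

/-- Maps into a representation. -/
def lift (p : M →ₗ[ℤ] B) (q : M →ₗ[ℤ] A) (hp : ∀ m, p (eIdem (1 : Fin 2) • m) = p m)
    (hq : ∀ m, q (eIdem (0 : Fin 2) • m) = q m) (h : ∀ m, q (arrowElt • m) = φ (p m)) :
    M →ₗ[SierpinskiAlgebra] ArrowRep φ :=
  linearMapOfBasis (N := ArrowRep φ)
    { toFun m := ((p m, q m) : B × A)
      map_zero' := ext (map_zero p) (map_zero q)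
      map_add' x y := ext (map_add p _ _) (map_add q _ _) }
    (fun m => by
      show ((p _, q _) : B × A) = eIdem (0 : Fin 2) • (show ArrowRep φ from (p m, q m))
      rw [eIdem_zero_smul, hq, ← hp, eIdem_one_smul_eIdem_zero_smul, map_zero])
    (fun m => by
      show ((p _, q _) : B × A) = eIdem (1 : Fin 2) • (show ArrowRep φ from (p m, q m))
      rw [eIdem_one_smul, hp, ← hq, eIdem_zero_smul_eIdem_one_smul, map_zero])
    (fun m => by
      show ((p _, q _) : B × A) = arrowElt • (show ArrowRep φ from (p m, q m))
      rw [arrowElt_smul, h, ← hp, eIdem_one_smul_arrowElt_smul, map_zero])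

variable (φ) in
/-- The object of `ModuleCat` attached to a structure map. -/
abbrev obj : ModuleCat.{0} SierpinskiAlgebra := ModuleCat.of SierpinskiAlgebra (ArrowRep φ)

section ShortExact

variable (β : B₁ →ₗ[ℤ] B₂) (β' : B₂ →ₗ[ℤ] B₃) (α : A₁ →ₗ[ℤ] A₂) (α' : A₂ →ₗ[ℤ] A₃)
  (h : ∀ b, φ₂ (β b) = α (φ₁ b)) (h' : ∀ b, φ₃ (β' b) = α' (φ₂ b))
  (hβ : Function.Exact β β') (hα : Function.Exact α α')

/-- The short complex of representations with given components. -/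
abbrev shortComplex : ShortComplex (ModuleCat.{0} SierpinskiAlgebra) :=
  ShortComplex.mk (X₁ := obj φ₁) (X₂ := obj φ₂) (X₃ := obj φ₃)
    (ModuleCat.ofHom (map β α h)) (ModuleCat.ofHom (map β' α' h'))
    (ModuleCat.hom_ext (LinearMap.ext fun x =>
      ArrowRep.ext (φ := φ₃) (hβ.apply_apply_eq_zero x.1) (hα.apply_apply_eq_zero x.2)))

lemma shortComplex_shortExact (iβ : Function.Injective β) (iα : Function.Injective α)
    (sβ : Function.Surjective β') (sα : Function.Surjective α') :
    (shortComplex β β' α α' h h' hβ hα).ShortExact :=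
  ModuleCat.shortComplex_shortExact _
    (fun y => by
      constructor
      · intro hy
        obtain ⟨b, hb⟩ := (hβ y.1).1 (congrArg Prod.fst hy)
        obtain ⟨a, ha⟩ := (hα y.2).1 (congrArg Prod.snd hy)
        exact ⟨((b, a) : B₁ × A₁), ArrowRep.ext (φ := φ₂) hb ha⟩
      · rintro ⟨x, rfl⟩
        exact ArrowRep.ext (φ := φ₃) (hβ.apply_apply_eq_zero x.1) (hα.apply_apply_eq_zero x.2))
    (fun x y hxy => ArrowRep.ext (φ := φ₁) (iβ (congrArg Prod.fst hxy))
      (iα (congrArg Prod.snd hxy)))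
    (fun z => by
      obtain ⟨b, hb⟩ := sβ z.1
      obtain ⟨a, ha⟩ := sα z.2
      exact ⟨((b, a) : B₂ × A₂), ArrowRep.ext (φ := φ₃) hb ha⟩)

end ShortExact

section Dimension

instance projective_id (F : Type) [AddCommGroup F] [Module.Projective ℤ F] :
    Module.Projective SierpinskiAlgebra (ArrowRep (LinearMap.id : F →ₗ[ℤ] F)) :=
  .of_lifting_property'' fun f hf => by
    let p : (ArrowRep (LinearMap.id : F →ₗ[ℤ] F) →₀ SierpinskiAlgebra) →ₗ[ℤ] F :=
      ((AddMonoidHom.fst F F).comp f.toAddMonoidHom).toIntLinearMap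
    have hp : Function.Surjective p := fun b => by
      obtain ⟨m, hm⟩ := hf ((b, 0) : F × F)
      exact ⟨m, congrArg Prod.fst hm⟩
    obtain ⟨s, hs⟩ := Module.projective_lifting_property p LinearMap.id hp
    have hs' (b : F) : (f (s b)).1 = b := LinearMap.congr_fun hs b
    refine ⟨desc
      ((DistribSMul.toAddMonoidHom _ (eIdem (1 : Fin 2) : SierpinskiAlgebra)).toIntLinearMap.comp s)
      ((DistribSMul.toAddMonoidHom _ arrowElt).toIntLinearMap.comp s)
      (fun b => eIdem_smul_eIdem_smul _ _) (fun b => eIdem_zero_smul_arrowElt_smul _)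
      (fun b => arrowElt_smul_eIdem_one_smul (s b)), LinearMap.ext fun x => ?_⟩
    show f (eIdem (1 : Fin 2) • s x.1 + arrowElt • s x.2) = x
    rw [map_add, map_smul, map_smul, eIdem_one_smul, arrowElt_smul, hs', hs']
    exact ext (add_zero _) (zero_add _)

instance projective_zero (F : Type) [AddCommGroup F] [Module.Projective ℤ F] :
    Module.Projective SierpinskiAlgebra (ArrowRep (0 : PUnit.{1} →ₗ[ℤ] F)) :=
  .of_lifting_property'' fun f hf => by
    let q : (ArrowRep (0 : PUnit.{1} →ₗ[ℤ] F) →₀ SierpinskiAlgebra) →ₗ[ℤ] F :=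
      ((AddMonoidHom.snd PUnit.{1} F).comp f.toAddMonoidHom).toIntLinearMap
    have hq : Function.Surjective q := fun a => by
      obtain ⟨m, hm⟩ := hf ((0, a) : PUnit.{1} × F)
      exact ⟨m, congrArg Prod.snd hm⟩
    obtain ⟨s, hs⟩ := Module.projective_lifting_property q LinearMap.id hq
    have hs' (a : F) : (f (s a)).2 = a := LinearMap.congr_fun hs a
    refine ⟨desc 0
      ((DistribSMul.toAddMonoidHom _ (eIdem (0 : Fin 2) : SierpinskiAlgebra)).toIntLinearMap.comp s)
      (fun b => smul_zero _) (fun b => eIdem_smul_eIdem_smul _ _)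
      (fun b => (smul_zero _).trans (map_zero _).symm), LinearMap.ext fun x => ?_⟩
    show f (0 + eIdem (0 : Fin 2) • s x.2) = x
    rw [zero_add, map_smul, eIdem_zero_smul, hs']
    rfl

instance injective_id (Q : Type) [AddCommGroup Q] [Module.Injective ℤ Q] :
    Module.Injective SierpinskiAlgebra (ArrowRep (LinearMap.id : Q →ₗ[ℤ] Q)) where
  out X Y _ _ _ _ f hf g := by
    let q : X →ₗ[ℤ] Q := ((AddMonoidHom.snd Q Q).comp g.toAddMonoidHom).toIntLinearMap
    obtain ⟨k, hk⟩ := Module.Injective.out f.toAddMonoidHom.toIntLinearMap hf q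
    have hk' (x : X) : k (f x) = (g x).2 := hk x
    refine ⟨lift (k.comp (DistribSMul.toAddMonoidHom Y arrowElt).toIntLinearMap)
      (k.comp (DistribSMul.toAddMonoidHom Y (eIdem (0 : Fin 2) : SierpinskiAlgebra)).toIntLinearMap)
      (fun m => congrArg k (arrowElt_smul_eIdem_one_smul m))
      (fun m => congrArg k (eIdem_smul_eIdem_smul _ m))
      (fun m => congrArg k (eIdem_zero_smul_arrowElt_smul m)), fun x => ?_⟩
    refine ext ?_ ?_
    · show k (arrowElt • f x) = _
      rw [← map_smul, hk', map_smul, arrowElt_smul]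
      rfl
    · show k (eIdem (0 : Fin 2) • f x) = _
      rw [← map_smul, hk', map_smul, eIdem_zero_smul]

instance injective_zero (Q : Type) [AddCommGroup Q] [Module.Injective ℤ Q] :
    Module.Injective SierpinskiAlgebra (ArrowRep (0 : Q →ₗ[ℤ] PUnit.{1})) where
  out X Y _ _ _ _ f hf g := by
    let p : X →ₗ[ℤ] Q := ((AddMonoidHom.fst Q PUnit.{1}).comp g.toAddMonoidHom).toIntLinearMap
    obtain ⟨k, hk⟩ := Module.Injective.out f.toAddMonoidHom.toIntLinearMap hf p
    have hk' (x : X) : k (f x) = (g x).1 := hk x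
    refine ⟨lift
      (k.comp (DistribSMul.toAddMonoidHom Y (eIdem (1 : Fin 2) : SierpinskiAlgebra)).toIntLinearMap)
      0 (fun m => congrArg k (eIdem_smul_eIdem_smul _ m)) (fun m => rfl) (fun m => rfl),
      fun x => ?_⟩
    refine ext ?_ rfl
    show k (eIdem (1 : Fin 2) • f x) = _
    rw [← map_smul, hk', map_smul, eIdem_one_smul]

/-- The resolution of the constant representation induced by a short exact sequence. -/
lemma shortExact_id (f : A₁ →ₗ[ℤ] A₂) (g : A₂ →ₗ[ℤ] A₃) (hf : Function.Injective f)
    (hg : Function.Surjective g) (h : Function.Exact f g) :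
    (shortComplex (φ₁ := LinearMap.id) (φ₂ := LinearMap.id) (φ₃ := LinearMap.id) f g f g
      (fun _ => rfl) (fun _ => rfl) h h).ShortExact :=
  shortComplex_shortExact _ _ _ _ _ _ _ _ hf hf hg hg

lemma exact_punit : Function.Exact (LinearMap.id : PUnit.{1} →ₗ[ℤ] PUnit.{1})
    (LinearMap.id : PUnit.{1} →ₗ[ℤ] PUnit.{1}) := fun _ => ⟨fun _ => ⟨0, rfl⟩, fun _ => rfl⟩

lemma shortExact_zero_left (f : A₁ →ₗ[ℤ] A₂) (g : A₂ →ₗ[ℤ] A₃) (hf : Function.Injective f)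
    (hg : Function.Surjective g) (h : Function.Exact f g) :
    (shortComplex (φ₁ := 0) (φ₂ := 0) (φ₃ := 0) LinearMap.id LinearMap.id f g
      (fun _ => (map_zero f).symm) (fun _ => (map_zero g).symm) exact_punit h).ShortExact :=
  shortComplex_shortExact _ _ _ _ _ _ _ _ Function.injective_id hf Function.surjective_id hg

lemma shortExact_zero_right (f : A₁ →ₗ[ℤ] A₂) (g : A₂ →ₗ[ℤ] A₃) (hf : Function.Injective f)
    (hg : Function.Surjective g) (h : Function.Exact f g) :
    (shortComplex (φ₁ := 0) (φ₂ := 0) (φ₃ := 0) f g LinearMap.id LinearMap.id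
      (fun _ => rfl) (fun _ => rfl) h exact_punit).ShortExact :=
  shortComplex_shortExact _ _ _ _ _ _ _ _ hf Function.injective_id hg Function.surjective_id

instance projective_obj_id (F : Type) [AddCommGroup F] [Module.Projective ℤ F] :
    Projective (obj (LinearMap.id : F →ₗ[ℤ] F)) :=
  (IsProjective.iff_projective _).1 (projective_id F)

instance projective_obj_zero (F : Type) [AddCommGroup F] [Module.Projective ℤ F] :
    Projective (obj (0 : PUnit.{1} →ₗ[ℤ] F)) :=
  (IsProjective.iff_projective _).1 (projective_zero F)

variable (M : Type) [AddCommGroup M]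

lemma exists_injective_resolution : ∃ (Q₀ Q₁ : Type) (_ : AddCommGroup Q₀) (_ : AddCommGroup Q₁)
    (f : M →ₗ[ℤ] Q₀) (g : Q₀ →ₗ[ℤ] Q₁), Module.Injective ℤ Q₀ ∧ Module.Injective ℤ Q₁ ∧
      Function.Injective f ∧ Function.Surjective g ∧ Function.Exact f g := by
  let f : M →ₗ[ℤ] (CharacterModule M → AddCircle (1 : ℚ)) :=
    LinearMap.pi fun c => AddMonoidHom.toIntLinearMap c
  have hf : Function.Injective f := (injective_iff_map_eq_zero f).2 fun m hm =>
    CharacterModule.eq_zero_of_character_apply fun c => congrFun hm c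
  let : DivisibleBy ((CharacterModule M → AddCircle (1 : ℚ)) ⧸ LinearMap.range f) ℤ :=
    (Submodule.mkQ_surjective (LinearMap.range f)).divisibleBy _ fun q n => map_smul _ n q
  exact ⟨_, _, inferInstance, inferInstance, f, (LinearMap.range f).mkQ,
    (Module.Baer.of_divisible _).injective, (Module.Baer.of_divisible _).injective, hf,
    Submodule.mkQ_surjective _, LinearMap.exact_map_mkQ_range f⟩

lemma hasInjectiveDimensionLT_int (Y : ModuleCat.{0} ℤ) : HasInjectiveDimensionLT Y 2 := by
  rcases Y with @⟨M, _, hM⟩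
  obtain rfl : hM = AddCommGroup.toIntModule M := Subsingleton.elim _ _
  obtain ⟨Q₀, Q₁, _, _, f, g, _, _, hf, hg, h⟩ := exists_injective_resolution M
  have hS := ModuleCat.shortComplex_shortExact
    (ModuleCat.shortComplexOfCompEqZero f g h.linearMap_comp_eq_zero) h hf hg
  have : Injective (ModuleCat.of ℤ Q₀) := Module.injective_object_of_injective_module _ _
  have : Injective (ModuleCat.of ℤ Q₁) := Module.injective_object_of_injective_module _ _
  exact hS.hasInjectiveDimensionLT_X₁ 1
    (inferInstanceAs (HasInjectiveDimensionLT (ModuleCat.of ℤ Q₁) 1))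
    (inferInstanceAs (HasInjectiveDimensionLT (ModuleCat.of ℤ Q₀) 2))

lemma hasProjectiveDimensionLT_int (Y : ModuleCat.{0} ℤ) : HasProjectiveDimensionLT Y 2 :=
  HasProjectiveDimensionLT.mk fun _ hi Z e =>
    have := hasInjectiveDimensionLT_int Z
    e.eq_zero_of_hasInjectiveDimensionLT 2 hi

/-- Subgroups of free abelian groups are projective, so resolutions of length one exist. -/
lemma exists_projective_resolution : ∃ (F₁ F₀ : Type) (_ : AddCommGroup F₁) (_ : AddCommGroup F₀)
    (f : F₁ →ₗ[ℤ] F₀) (g : F₀ →ₗ[ℤ] M), Module.Projective ℤ F₁ ∧ Module.Projective ℤ F₀ ∧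
      Function.Injective f ∧ Function.Surjective g ∧ Function.Exact f g := by
  let g := Finsupp.linearCombination ℤ (id : M → M)
  have hg : Function.Surjective g := Finsupp.linearCombination_id_surjective ℤ M
  have hS := LinearMap.shortExact_shortComplexKer hg
  have : Projective (ModuleCat.of ℤ (M →₀ ℤ)) := (IsProjective.iff_projective _).1 inferInstance
  have : Module.Projective ℤ (LinearMap.ker g) := by
    refine (IsProjective.iff_projective _).2 ?_
    rw [projective_iff_hasProjectiveDimensionLT_one]
    exact (hS.hasProjectiveDimensionLT_X₃_iff 0 this).1 (hasProjectiveDimensionLT_int _)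
  exact ⟨LinearMap.ker g, M →₀ ℤ, inferInstance, inferInstance, (LinearMap.ker g).subtype, g,
    this, inferInstance, Subtype.val_injective, hg, LinearMap.exact_subtype_ker_map g⟩

lemma hasProjectiveDimensionLT_id :
    HasProjectiveDimensionLT (obj (LinearMap.id : M →ₗ[ℤ] M)) 2 := by
  obtain ⟨F₁, F₀, _, _, f, g, _, _, hf, hg, h⟩ := exists_projective_resolution M
  exact (shortExact_id f g hf hg h).hasProjectiveDimensionLT_X₃ 1
    (inferInstanceAs (HasProjectiveDimensionLT (obj (LinearMap.id : F₁ →ₗ[ℤ] F₁)) 1))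
    (inferInstanceAs (HasProjectiveDimensionLT (obj (LinearMap.id : F₀ →ₗ[ℤ] F₀)) 2))

lemma hasProjectiveDimensionLT_zero :
    HasProjectiveDimensionLT (obj (0 : PUnit.{1} →ₗ[ℤ] M)) 2 := by
  obtain ⟨F₁, F₀, _, _, f, g, _, _, hf, hg, h⟩ := exists_projective_resolution M
  exact (shortExact_zero_left f g hf hg h).hasProjectiveDimensionLT_X₃ 1
    (inferInstanceAs (HasProjectiveDimensionLT (obj (0 : PUnit.{1} →ₗ[ℤ] F₁)) 1))
    (inferInstanceAs (HasProjectiveDimensionLT (obj (0 : PUnit.{1} →ₗ[ℤ] F₀)) 2))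

lemma hasInjectiveDimensionLT_id :
    HasInjectiveDimensionLT (obj (LinearMap.id : M →ₗ[ℤ] M)) 2 := by
  obtain ⟨Q₀, Q₁, _, _, f, g, _, _, hf, hg, h⟩ := exists_injective_resolution M
  have : Injective (obj (LinearMap.id : Q₀ →ₗ[ℤ] Q₀)) :=
    Module.injective_object_of_injective_module _ _
  have : Injective (obj (LinearMap.id : Q₁ →ₗ[ℤ] Q₁)) :=
    Module.injective_object_of_injective_module _ _
  exact (shortExact_id f g hf hg h).hasInjectiveDimensionLT_X₁ 1
    (inferInstanceAs (HasInjectiveDimensionLT (obj (LinearMap.id : Q₁ →ₗ[ℤ] Q₁)) 1))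
    (inferInstanceAs (HasInjectiveDimensionLT (obj (LinearMap.id : Q₀ →ₗ[ℤ] Q₀)) 2))

lemma hasInjectiveDimensionLT_zero :
    HasInjectiveDimensionLT (obj (0 : M →ₗ[ℤ] PUnit.{1})) 2 := by
  obtain ⟨Q₀, Q₁, _, _, f, g, _, _, hf, hg, h⟩ := exists_injective_resolution M
  have : Injective (obj (0 : Q₀ →ₗ[ℤ] PUnit.{1})) :=
    Module.injective_object_of_injective_module _ _
  have : Injective (obj (0 : Q₁ →ₗ[ℤ] PUnit.{1})) :=
    Module.injective_object_of_injective_module _ _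
  exact (shortExact_zero_right f g hf hg h).hasInjectiveDimensionLT_X₁ 1
    (inferInstanceAs (HasInjectiveDimensionLT (obj (0 : Q₁ →ₗ[ℤ] PUnit.{1})) 1))
    (inferInstanceAs (HasInjectiveDimensionLT (obj (0 : Q₀ →ₗ[ℤ] PUnit.{1})) 2))

end Dimension

section RestrictScalars

instance : (ModuleCat.restrictScalars.{0} evalZero).Faithful where
  map_injective h := ModuleCat.hom_ext (LinearMap.ext fun x => LinearMap.congr_fun
    (congrArg ModuleCat.Hom.hom h) x)

instance : (ModuleCat.restrictScalars.{0} evalZero).Full where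
  map_surjective {M N} f :=
    ⟨ModuleCat.ofHom
      { toFun := fun m : M => (f.hom m : N)
        map_add' := map_add f.hom
        map_smul' := by
          let g : M →+ N := f.hom.toAddMonoidHom
          exact map_intCast_smul g ℤ ℤ }, rfl⟩

/-- Restriction along `evalZero` gives the representations concentrated at the bottom vertex. -/
def objZeroIso (M : Type) [AddCommGroup M] :
    obj (0 : PUnit.{1} →ₗ[ℤ] M) ≅
      (ModuleCat.restrictScalars evalZero).obj (ModuleCat.of ℤ M) :=
  LinearEquiv.toModuleIso (X₂ := (ModuleCat.restrictScalars evalZero).obj (ModuleCat.of ℤ M))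
    (m₂ := ModuleCat.isModule _)
    { toFun := fun x : ArrowRep (0 : PUnit.{1} →ₗ[ℤ] M) => (x.2 : M)
      map_add' := fun _ _ => rfl
      map_smul' := fun r x => by
        show r 0 0 • x.2 + r 0 1 • (0 : M) = r 0 0 • x.2
        rw [smul_zero, add_zero]
      invFun := fun m => ((0, m) : PUnit.{1} × M)
      left_inv := fun _ => rfl
      right_inv := fun _ => rfl }

lemma preservesFinite_restrictScalars_evalZero :
    Limits.PreservesFiniteLimits (ModuleCat.restrictScalars.{0} evalZero) ∧
      Limits.PreservesFiniteColimits (ModuleCat.restrictScalars.{0} evalZero) :=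
  ((ModuleCat.restrictScalars.{0} evalZero).exact_tfae.out 1 3).1 fun S hS => by
    rw [ShortComplex.ShortExact.moduleCat_exact_iff_function_exact] at hS ⊢
    exact hS

instance : (ModuleCat.restrictScalars.{0} evalZero).PreservesProjectiveObjects where
  projective_obj {P} hP := by
    rcases P with @⟨M, _, hM⟩
    obtain rfl : hM = AddCommGroup.toIntModule M := Subsingleton.elim _ _
    have : Module.Projective ℤ M := (IsProjective.iff_projective _).2 hP
    exact Projective.of_iso (objZeroIso M) (projective_obj_zero M)

end RestrictScalars

section Ext

open Abelian

/-- Every module is the representation given by its structure map. -/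
def ofModuleIso (M : Type) [AddCommGroup M] [Module SierpinskiAlgebra M] :
    obj (upsSmul M 0 1 (by decide : (0 : Fin 2) ≤ 1)) ≅ ModuleCat.of SierpinskiAlgebra M :=
  have smul_coe {x : Fin 2} (v : eSub M x) : eIdem x • (v : M) = v := by
    obtain ⟨_, v, rfl⟩ := v
    exact eIdem_smul_eIdem_smul x v
  let F : ArrowRep (upsSmul M 0 1 (by decide : (0 : Fin 2) ≤ 1)) →ₗ[SierpinskiAlgebra] M :=
    desc (eSub M 1).subtype (eSub M 0).subtype smul_coe smul_coe (fun _ => rfl)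
  (LinearEquiv.ofBijective F
    ⟨(injective_iff_map_eq_zero F).2 fun x hx => by
      have hx : (x.1 : M) + (x.2 : M) = 0 := hx
      have h₀ : (x.2 : M) = 0 := by
        have := congrArg (eIdem (0 : Fin 2) • ·) hx
        simp only [smul_add] at this
        rwa [← smul_coe x.1, eIdem_zero_smul_eIdem_one_smul, smul_coe x.2, zero_add,
          smul_zero] at this
      rw [h₀, add_zero] at hx
      exact ext (Subtype.ext hx) (Subtype.ext h₀),
    fun v => ⟨((⟨eIdem (1 : Fin 2) • v, ⟨v, rfl⟩⟩, ⟨eIdem (0 : Fin 2) • v, ⟨v, rfl⟩⟩) :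
        eSub M (1 : Fin 2) × eSub M (0 : Fin 2)), by
      show eIdem (1 : Fin 2) • v + eIdem (0 : Fin 2) • v = v
      rw [← add_smul, add_comm, eIdem_zero_add_eIdem_one, one_smul]⟩⟩).toModuleIso

variable (φ : B →ₗ[ℤ] A)

/-- The kernel of the structure map is a subrepresentation concentrated at the top vertex. -/
lemma shortExact_ker :
    (shortComplex (φ₁ := (0 : LinearMap.ker φ →ₗ[ℤ] PUnit.{1})) (φ₂ := φ)
      (φ₃ := (LinearMap.range φ).subtype) (LinearMap.ker φ).subtype φ.rangeRestrict
      0 LinearMap.id (fun b => b.2) (fun _ => rfl)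
      (fun b => by simp [Subtype.ext_iff])
      (fun a => by simp [eq_comm])).ShortExact :=
  shortComplex_shortExact _ _ _ _ _ _ _ _ Subtype.val_injective
    (Function.injective_of_subsingleton _) φ.surjective_rangeRestrict Function.surjective_id

/-- The cokernel of the structure map is a quotient representation concentrated at the bottom
vertex. -/
lemma shortExact_coker :
    (shortComplex (φ₁ := φ.rangeRestrict) (φ₂ := φ)
      (φ₃ := (0 : PUnit.{1} →ₗ[ℤ] A ⧸ LinearMap.range φ)) LinearMap.id 0
      (LinearMap.range φ).subtype (LinearMap.range φ).mkQ (fun _ => rfl)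
      (fun b => ((Submodule.Quotient.mk_eq_zero _).2 (φ.mem_range_self b)).symm)
      (fun b => by simp)
      (LinearMap.exact_subtype_mkQ _)).ShortExact :=
  shortComplex_shortExact _ _ _ _ _ _ _ _ Function.injective_id Subtype.val_injective
    (Function.surjective_to_subsingleton _) (Submodule.mkQ_surjective _)

lemma shortExact_subtype (N : Submodule ℤ A) :
    (shortComplex (φ₁ := (LinearMap.id : N →ₗ[ℤ] N)) (φ₂ := N.subtype)
      (φ₃ := (0 : PUnit.{1} →ₗ[ℤ] A ⧸ N)) LinearMap.id 0
      N.subtype N.mkQ (fun _ => rfl)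
      (fun b => ((Submodule.Quotient.mk_eq_zero _).2 b.2).symm)
      (fun b => by simp)
      (LinearMap.exact_subtype_mkQ _)).ShortExact :=
  shortComplex_shortExact _ _ _ _ _ _ _ _ Function.injective_id Subtype.val_injective
    (Function.surjective_to_subsingleton _) (Submodule.mkQ_surjective _)

lemma shortExact_rangeRestrict :
    (shortComplex (φ₁ := (0 : LinearMap.ker φ →ₗ[ℤ] PUnit.{1})) (φ₂ := φ.rangeRestrict)
      (φ₃ := LinearMap.id) (LinearMap.ker φ).subtype φ.rangeRestrict
      0 LinearMap.id (fun b => Subtype.ext b.2) (fun _ => rfl)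
      (fun b => by simp [Subtype.ext_iff])
      (fun a => by simp [eq_comm])).ShortExact :=
  shortComplex_shortExact _ _ _ _ _ _ _ _ Subtype.val_injective
    (Function.injective_of_subsingleton _) φ.surjective_rangeRestrict Function.surjective_id

variable (A) in
/-- The constant representation is an extension of the two representations concentrated at a
vertex. -/
lemma shortExact_vertices :
    (shortComplex (φ₁ := (0 : PUnit.{1} →ₗ[ℤ] A)) (φ₂ := LinearMap.id)
      (φ₃ := (0 : A →ₗ[ℤ] PUnit.{1})) 0 LinearMap.id LinearMap.id 0
      (fun _ => by simp) (fun _ => rfl)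
      (fun b => by simp [eq_comm])
      (fun a => by simp)).ShortExact :=
  shortComplex_shortExact _ _ _ _ _ _ _ _ (Function.injective_of_subsingleton _)
    Function.injective_id Function.surjective_id (Function.surjective_to_subsingleton _)

lemma hasProjectiveDimensionLT_subtype (N : Submodule ℤ A) :
    HasProjectiveDimensionLT (obj N.subtype) 2 :=
  (shortExact_subtype N).hasProjectiveDimensionLT_X₂ 2
    (hasProjectiveDimensionLT_id N) (hasProjectiveDimensionLT_zero (A ⧸ N))

lemma hasInjectiveDimensionLT_rangeRestrict :
    HasInjectiveDimensionLT (obj φ.rangeRestrict) 2 :=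
  (shortExact_rangeRestrict φ).hasInjectiveDimensionLT_X₂ 2
    (hasInjectiveDimensionLT_zero (LinearMap.ker φ))
    (hasInjectiveDimensionLT_id (LinearMap.range φ))

lemma hom_id_zero_eq_zero
    (f : ArrowRep (LinearMap.id : A₁ →ₗ[ℤ] A₁) →ₗ[SierpinskiAlgebra]
      ArrowRep (0 : PUnit.{1} →ₗ[ℤ] A)) : f = 0 := by
  refine LinearMap.ext fun x => ?_
  let y : ArrowRep (LinearMap.id : A₁ →ₗ[ℤ] A₁) := ((x.2, 0) : A₁ × A₁)
  have hx : x = eIdem (1 : Fin 2) • x + arrowElt • y := by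
    rw [eIdem_one_smul, arrowElt_smul]
    exact ArrowRep.ext (add_zero _).symm (zero_add _).symm
  rw [hx, map_add, map_smul, map_smul, eIdem_one_smul, arrowElt_smul]
  exact ArrowRep.ext (φ := 0) rfl (add_zero _)

instance subsingleton_ext_one (K C : Type) [AddCommGroup K] [AddCommGroup C] :
    Subsingleton (Ext (obj (LinearMap.id : K →ₗ[ℤ] K)) (obj (0 : PUnit.{1} →ₗ[ℤ] C)) 1) := by
  obtain ⟨F₁, F₀, _, _, f, g, _, _, hf, hg, h⟩ := exists_projective_resolution K
  have hS := shortExact_id f g hf hg h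
  refine subsingleton_of_forall_eq 0 fun x => ?_
  have : Subsingleton (Ext (obj (LinearMap.id : F₀ →ₗ[ℤ] F₀)) (obj (0 : PUnit.{1} →ₗ[ℤ] C)) 1) :=
    HasProjectiveDimensionLT.subsingleton _ 1 1 le_rfl _
  obtain ⟨y, rfl⟩ := Ext.contravariant_sequence_exact₃ hS _ x (Subsingleton.elim _ _)
    (add_zero 1)
  rw [← Ext.mk₀_homEquiv₀_apply y,
    show Ext.homEquiv₀ y = 0 from ModuleCat.hom_ext (hom_id_zero_eq_zero _), Ext.mk₀_zero,
    Ext.comp_zero]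

theorem nonempty_ext_two_addEquiv (φ : B₁ →ₗ[ℤ] A₁) (ψ : B₂ →ₗ[ℤ] A₂) :
    Nonempty (Ext (obj φ) (obj ψ) 2 ≃+ Ext (ModuleCat.of ℤ (LinearMap.ker φ))
      (ModuleCat.of ℤ (A₂ ⧸ LinearMap.range ψ)) 1) := by
  have := hasProjectiveDimensionLT_subtype (LinearMap.range φ)
  have := hasInjectiveDimensionLT_rangeRestrict ψ
  have := hasProjectiveDimensionLT_id (LinearMap.ker φ)
  let K := obj (0 : LinearMap.ker φ →ₗ[ℤ] PUnit.{1})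
  let C := obj (0 : PUnit.{1} →ₗ[ℤ] A₂ ⧸ LinearMap.range ψ)
  have : Subsingleton (Ext (obj (LinearMap.range φ).subtype) (obj ψ) 2) :=
    HasProjectiveDimensionLT.subsingleton _ 2 2 le_rfl _
  have : Subsingleton (Ext (obj (LinearMap.range φ).subtype) (obj ψ) (1 + 2)) :=
    HasProjectiveDimensionLT.subsingleton _ 2 _ (by lia) _
  have : Subsingleton (Ext K (obj ψ.rangeRestrict) 2) :=
    HasInjectiveDimensionLT.subsingleton _ 2 2 le_rfl _
  have : Subsingleton (Ext K (obj ψ.rangeRestrict) (2 + 1)) :=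
    HasInjectiveDimensionLT.subsingleton _ 2 _ (by lia) _
  have : Subsingleton (Ext (obj (LinearMap.id : LinearMap.ker φ →ₗ[ℤ] _)) C (1 + 1)) :=
    HasProjectiveDimensionLT.subsingleton _ 2 2 le_rfl _
  have e₁ : Ext (obj φ) (obj ψ) 2 ≃+ Ext K (obj ψ) 2 :=
    .ofBijective _ (precomp_f_bijective (shortExact_ker φ) (obj ψ) 2)
  have e₂ : Ext K (obj ψ) 2 ≃+ Ext K C 2 :=
    .ofBijective _ (postcomp_g_bijective (shortExact_coker ψ) K 2)
  have e₃ : Ext (obj (0 : PUnit.{1} →ₗ[ℤ] LinearMap.ker φ)) C 1 ≃+ Ext K C 2 :=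
    .ofBijective _ (extClass_precomp_bijective (shortExact_vertices (LinearMap.ker φ)) C 1)
  obtain ⟨_, _⟩ := preservesFinite_restrictScalars_evalZero
  have e₄ := AddEquiv.ofBijective _
    ((ModuleCat.restrictScalars evalZero).mapExt_bijective_of_preservesProjectiveObjects
      (ModuleCat.of ℤ (LinearMap.ker φ)) (ModuleCat.of ℤ (A₂ ⧸ LinearMap.range ψ)) 1)
  exact ⟨e₁.trans (e₂.trans (e₃.symm.trans
    ((extAddEquivOfIso (objZeroIso _) (objZeroIso _) 1).trans e₄.symm)))⟩

end Ext

end ArrowRep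

end SierpinskiReps

theorem sierpinski_ext_two_iso
    (V W : Type) [AddCommGroup V] [AddCommGroup W]
    [Module (IncidenceAlgebra ℤ (Fin 2)) V] [Module (IncidenceAlgebra ℤ (Fin 2)) W] :
    Nonempty
      (Abelian.Ext (ModuleCat.of (IncidenceAlgebra ℤ (Fin 2)) V)
          (ModuleCat.of (IncidenceAlgebra ℤ (Fin 2)) W) 2 ≃+
        Abelian.Ext
          (ModuleCat.of ℤ
            (LinearMap.ker (upsSmul V 0 1 (by decide : (0 : Fin 2) ≤ 1))))
          (ModuleCat.of ℤ
            (eSub W 0 ⧸ LinearMap.range (upsSmul W 0 1 (by decide : (0 : Fin 2) ≤ 1))))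
          1) := by
  obtain ⟨e⟩ := ArrowRep.nonempty_ext_two_addEquiv
    (upsSmul V 0 1 (by decide : (0 : Fin 2) ≤ 1)) (upsSmul W 0 1 (by decide : (0 : Fin 2) ≤ 1))
  exact ⟨(extAddEquivOfIso (ArrowRep.ofModuleIso V).symm (ArrowRep.ofModuleIso W).symm 2).trans e⟩

end
end
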